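/- arXiv:2512.08840 — 2 statements merged into one kernel-verified Lean document; each statement's English description precedes it below -/
import Mathlib

section
/- Fix R > 0 large enough that φ(R)² > 2/3 and R exceeds the threshold R₀ of the coercivity lemma for Q_R. Then the kink is orbitally stable: for every ε > 0 there exists δ > 0 such that if ψ : ℝ × ℝ → ℂ is smooth, satisfies the cubic–quintic NLS equation i ∂_t ψ = ∂_x² ψ - ψ + 4 |ψ|² ψ - 3 |ψ|⁴ ψ pointwise on ℝ × ℝ, for every t ∈ ℝ the profile ψ(t,·) satisfies ∂_x ψ(t,·) - φ' ∈ L²(ℝ), ∫_ℝ W_R |ψ(t,·) - φ|² dx < ∞, |ψ(t,·)|² - φ² ∈ L²(R, ∞), the energy is conserved, E(ψ(t,·)) = E(ψ(0,·)) for all t, the map t ↦ inf_{α,β ∈ ℝ} ρ_R(e^{iα} ψ(t, · + β), φ) is continuous, and the initial datum satisfies ρ_R(ψ(0,·), φ) ≤ δ², then for all t ∈ ℝ: inf_{α,β ∈ ℝ} ρ_R(e^{iα} ψ(t, · + β), φ) ≤ ε². -/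
open Real MeasureTheory Set ENNReal

noncomputable def φ (x : ℝ) : ℝ := Real.sqrt ((1 + Real.tanh x) / 2)

/-- The weight of the Hilbert space `𝓗_R`. -/
noncomputable def W (R x : ℝ) : ℝ :=
  if x ≤ R then 1 else (1 - (φ x) ^ 2) / (1 - (φ R) ^ 2)

/-- The distance `ρ_R(ψ, φ)` to the kink. -/
noncomputable def rho (R : ℝ) (ψ : ℝ → ℂ) : ℝ≥0∞ :=
  (∫⁻ x : ℝ, (‖deriv ψ x - ((deriv φ x : ℝ) : ℂ)‖₊ : ℝ≥0∞) ^ 2) +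
  (∫⁻ x : ℝ, ENNReal.ofReal (W R x) * (‖ψ x - (φ x : ℂ)‖₊ : ℝ≥0∞) ^ 2) +
  ∫⁻ x in Ioi R, ENNReal.ofReal ((‖ψ x‖ ^ 2 - (φ x) ^ 2) ^ 2)

/-- The energy of the cubic–quintic NLS equation (as a nonnegative extended real). -/
noncomputable def energy (ψ : ℝ → ℂ) : ℝ≥0∞ :=
  ∫⁻ x : ℝ, ENNReal.ofReal (‖deriv ψ x‖ ^ 2 + ‖ψ x‖ ^ 2 * (1 - ‖ψ x‖ ^ 2) ^ 2)

section
open Real MeasureTheory Set ENNReal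

/-! ### Basic facts on the kink -/

lemma phi_sq (x : ℝ) : φ x ^ 2 = 1 / (1 + Real.exp (-(2 * x))) := by
  have h1 := Real.neg_one_lt_tanh x
  rw [φ, Real.sq_sqrt (by linarith), Real.tanh_eq]
  have e1 : Real.exp (-(2 * x)) = Real.exp (-x) * Real.exp (-x) := by
    rw [← Real.exp_add]; ring_nf
  have e2 : Real.exp x * Real.exp (-x) = 1 := by rw [← Real.exp_add]; simp
  have p1 := Real.exp_pos x
  have p2 := Real.exp_pos (-x)
  rw [e1]
  have : 1 + Real.exp (-x) * Real.exp (-x) = Real.exp (-x) * (Real.exp x + Real.exp (-x)) := by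
    rw [← e2]; ring
  rw [this]
  field_simp
  nlinarith

/-- The weight `1 - φ²`. -/
noncomputable def om (x : ℝ) : ℝ := 1 - φ x ^ 2

lemma om_eq (x : ℝ) : om x = 1 / (1 + Real.exp (2 * x)) := by
  have e2 : Real.exp (2 * x) * Real.exp (-(2 * x)) = 1 := by rw [← Real.exp_add]; simp
  have p1 := Real.exp_pos (2 * x)
  have p2 := Real.exp_pos (-(2 * x))
  rw [om, phi_sq]
  field_simp
  nlinarith

lemma om_pos (x : ℝ) : 0 < om x := by rw [om_eq]; positivity

lemma om_lt_one (x : ℝ) : om x < 1 := by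
  rw [om_eq, div_lt_one (by positivity)]
  linarith [Real.exp_pos (2 * x)]

lemma phi_pos (x : ℝ) : 0 < φ x := by
  have h : 0 < φ x ^ 2 := by rw [phi_sq]; positivity
  have h0 : 0 ≤ φ x := Real.sqrt_nonneg _
  rcases h0.lt_or_eq with h1 | h1
  · exact h1
  · rw [← h1] at h; norm_num at h

lemma phi_sq_eq (x : ℝ) : φ x ^ 2 = 1 - om x := by rw [om]; ring

lemma phi_lt_one (x : ℝ) : φ x < 1 := by
  have := om_pos x
  have h := phi_sq_eq x
  nlinarith [phi_pos x]

lemma phi_hasDerivAt (x : ℝ) : HasDerivAt φ (φ x * om x) x := by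
  have h1 := phi_pos x
  have hf : φ = fun y => Real.sqrt (1 / (1 + Real.exp (-(2 * y)))) := by
    funext y
    rw [← phi_sq, Real.sqrt_sq (phi_pos y).le]
  have hd : HasDerivAt (fun y : ℝ => 1 / (1 + Real.exp (-(2 * y))))
      (2 * φ x ^ 2 * om x) x := by
    have h2 : HasDerivAt (fun y : ℝ => 1 + Real.exp (-(2 * y)))
        (Real.exp (-(2 * x)) * (-(2 * 1))) x :=
      ((((hasDerivAt_id x).const_mul 2).neg).exp).const_add 1
    have h3 := h2.inv (by positivity)
    have e : (2 * φ x ^ 2 * om x) =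
        -(Real.exp (-(2 * x)) * (-(2 * 1))) / (1 + Real.exp (-(2 * x))) ^ 2 := by
      rw [om, phi_sq]
      have p2 := Real.exp_pos (-(2 * x))
      field_simp
      ring
    rw [e]
    simp only [one_div]
    exact h3
  have h4 := hd.sqrt (by rw [← phi_sq]; positivity)
  rw [← hf] at h4
  convert h4 using 1
  rw [← phi_sq, Real.sqrt_sq h1.le]
  field_simp

lemma phi_deriv (x : ℝ) : deriv φ x = φ x * om x := (phi_hasDerivAt x).deriv

lemma phi_cont : Continuous φ :=
  continuous_iff_continuousAt.2 fun x => (phi_hasDerivAt x).continuousAt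

lemma om_cont : Continuous om := by
  unfold om
  exact continuous_const.sub (phi_cont.pow 2)

lemma om_hasDerivAt (x : ℝ) : HasDerivAt om (-(2 * φ x ^ 2 * om x)) x := by
  have h := ((phi_hasDerivAt x).pow 2).const_sub 1
  exact h.congr_deriv (by push_cast; ring)

/-- The derivative of the kink as a function. -/
noncomputable def dphi (x : ℝ) : ℝ := φ x * om x

lemma dphi_pos (x : ℝ) : 0 < dphi x := mul_pos (phi_pos x) (om_pos x)
lemma dphi_cont : Continuous dphi := phi_cont.mul om_cont
lemma dphi_lt_one (x : ℝ) : dphi x < 1 := by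
  have := phi_pos x; have := om_pos x; have := phi_lt_one x; have := om_lt_one x
  unfold dphi; nlinarith

lemma dphi_hasDerivAt (x : ℝ) : HasDerivAt dphi (dphi x * (1 - 3 * φ x ^ 2)) x := by
  have h := (phi_hasDerivAt x).mul (om_hasDerivAt x)
  exact h.congr_deriv (by unfold dphi om; ring)

lemma phi_mono : StrictMono φ :=
  strictMono_of_deriv_pos fun x => by rw [phi_deriv]; exact dphi_pos x

lemma om_anti {x y : ℝ} (h : x ≤ y) : om y ≤ om x := by
  have := phi_mono.monotone h
  have := phi_pos x
  unfold om
  nlinarith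

lemma phi_lip (x y : ℝ) : |φ x - φ y| ≤ |x - y| := by
  have := Convex.norm_image_sub_le_of_norm_deriv_le (f := φ) (C := 1) (s := Set.univ)
    (x := y) (y := x)
    (fun x _ => (phi_hasDerivAt x).differentiableAt)
    (fun x _ => by
      rw [phi_deriv, Real.norm_eq_abs, show φ x * om x = dphi x from rfl, abs_of_pos (dphi_pos x)]; exact (dphi_lt_one x).le)
    convex_univ (Set.mem_univ _) (Set.mem_univ _)
  simpa using this

lemma integrable_deriv_of_bdd {g g' : ℝ → ℝ} (hd : ∀ x, HasDerivAt g (g' x) x)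
    (hc : Continuous g') (hn : ∀ x, 0 ≤ g' x) (hb : ∀ x, |g x| ≤ 1) : Integrable g' := by
  refine integrable_of_intervalIntegral_norm_bounded (ι := ℕ) (l := Filter.atTop)
    (a := fun n => -(n : ℝ)) (b := fun n => (n : ℝ)) 2 (fun i => hc.integrableOn_Ioc)
    (Filter.tendsto_neg_atTop_atBot.comp tendsto_natCast_atTop_atTop)
    tendsto_natCast_atTop_atTop (Filter.Eventually.of_forall fun n => ?_)
  have : ∫ x in (-(n : ℝ))..n, ‖g' x‖ = g n - g (-n) := by
    rw [← intervalIntegral.integral_eq_sub_of_hasDerivAt (fun x _ => hd x)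
      (hc.intervalIntegrable _ _)]
    refine intervalIntegral.integral_congr fun x _ => ?_
    simp [abs_of_nonneg (hn x)]
  rw [this]
  have h1 := abs_le.1 (hb n)
  have h2 := abs_le.1 (hb (-n))
  linarith

lemma dphi_int : Integrable dphi :=
  integrable_deriv_of_bdd (g := φ) phi_hasDerivAt dphi_cont (fun x => (dphi_pos x).le)
    (fun x => by rw [abs_of_pos (phi_pos x)]; exact (phi_lt_one x).le)

lemma phi_dphi_int : Integrable (fun x => φ x ^ 2 * om x) := by
  refine integrable_deriv_of_bdd (g := fun x => -om x / 2) (fun x => ?_)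
    ((phi_cont.pow 2).mul om_cont) (fun x => ?_) (fun x => ?_)
  · exact ((om_hasDerivAt x).neg.div_const 2).congr_deriv (by ring)
  · have := om_pos x; positivity
  · have := om_pos x; have := om_lt_one x
    rw [abs_le]; constructor <;> linarith

lemma dphi_sq_int : Integrable (fun x => dphi x ^ 2) := by
  refine phi_dphi_int.mono' (dphi_cont.pow 2).aestronglyMeasurable
    (Filter.Eventually.of_forall fun x => ?_)
  have := om_pos x; have := om_lt_one x; have := phi_pos x
  rw [Real.norm_eq_abs, abs_of_nonneg (by positivity)]
  unfold dphi
  rw [mul_pow]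
  gcongr
  nlinarith

lemma om_le_shift (x b : ℝ) : om x ≤ Real.exp (2 * |b|) * om (x + b) := by
  rw [om_eq, om_eq, mul_one_div, div_le_div_iff₀ (by positivity) (by positivity), one_mul]
  have h1 : Real.exp (2 * (x + b)) ≤ Real.exp (2 * |b|) * Real.exp (2 * x) := by
    rw [← Real.exp_add]
    exact Real.exp_le_exp.2 (by linarith [le_abs_self b])
  have h2 : 1 ≤ Real.exp (2 * |b|) := Real.one_le_exp (by positivity)
  nlinarith

/-- Cauchy-Schwarz. -/
lemma cs_int {μ : Measure ℝ} {f g : ℝ → ℝ} (hf : Integrable (fun x => f x ^ 2) μ)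
    (hg : Integrable (fun x => g x ^ 2) μ) (hfg : Integrable (fun x => f x * g x) μ) :
    (∫ x, f x * g x ∂μ) ^ 2 ≤ (∫ x, f x ^ 2 ∂μ) * ∫ x, g x ^ 2 ∂μ := by
  have key : ∀ s : ℝ, 0 ≤ (∫ x, f x ^ 2 ∂μ) * (s * s) + (2 * ∫ x, f x * g x ∂μ) * s
      + ∫ x, g x ^ 2 ∂μ := by
    intro s
    have h : ∫ x, (s * f x + g x) ^ 2 ∂μ = (∫ x, f x ^ 2 ∂μ) * (s * s) +
        (2 * ∫ x, f x * g x ∂μ) * s + ∫ x, g x ^ 2 ∂μ := by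
      have e : (fun x => (s * f x + g x) ^ 2) =
          fun x => ((s * s) * f x ^ 2 + (2 * s) * (f x * g x)) + g x ^ 2 := by
        funext x; ring
      have h12 : Integrable (fun x => (s * s) * f x ^ 2 + (2 * s) * (f x * g x)) μ :=
        (hf.const_mul _).add (hfg.const_mul _)
      rw [e, integral_add h12 hg,
        integral_add (hf.const_mul _) (hfg.const_mul _), integral_const_mul, integral_const_mul]
      ring
    rw [← h]
    exact integral_nonneg fun x => sq_nonneg _
  have := discrim_le_zero key
  unfold discrim at this
  nlinarith

/-- Hoelder continuity from square integrable derivative. -/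
lemma holder {f f' : ℝ → ℂ} (hd : ∀ x, HasDerivAt f (f' x) x) (hc : Continuous f')
    (hi : Integrable (fun x => ‖f' x‖ ^ 2)) (x y : ℝ) :
    ‖f y - f x‖ ^ 2 ≤ |y - x| * ∫ s, ‖f' s‖ ^ 2 := by
  wlog h : x ≤ y generalizing x y
  · have := this y x (by linarith)
    rwa [norm_sub_rev, abs_sub_comm] at this
  have e : f y - f x = ∫ s in x..y, f' s :=
    (intervalIntegral.integral_eq_sub_of_hasDerivAt (fun x _ => hd x)
      (hc.intervalIntegrable _ _)).symm
  have h1 : ‖f y - f x‖ ≤ ∫ s in Ioc x y, ‖f' s‖ * 1 := by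
    rw [e, intervalIntegral.integral_of_le h]
    simpa using norm_integral_le_integral_norm (μ := volume.restrict (Ioc x y)) f'
  have h2 := cs_int (μ := volume.restrict (Ioc x y)) (f := fun s => ‖f' s‖) (g := fun _ => 1)
    hi.integrableOn (by simp) (by simpa [IntegrableOn] using hc.norm.integrableOn_Ioc (a := x) (b := y) (μ := volume))
  have h3 : ∫ s in Ioc x y, ‖f' s‖ ^ 2 ≤ ∫ s, ‖f' s‖ ^ 2 :=
    setIntegral_le_integral hi (Filter.Eventually.of_forall fun s => by positivity)
  have h4 : ∫ s in Ioc x y, (1 : ℝ) ^ 2 = y - x := by simp [h]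
  have h5 : ‖f y - f x‖ ^ 2 ≤ (∫ s in Ioc x y, ‖f' s‖ * 1) ^ 2 := by gcongr
  rw [h4] at h2
  rw [abs_of_nonneg (by linarith)]
  nlinarith [sub_nonneg.2 h]
end

section
open Real MeasureTheory Set ENNReal

/-! ### Coercivity of the imaginary part -/

lemma phi_zero_sq : φ 0 ^ 2 = 1 / 2 := by rw [phi_sq]; norm_num

lemma hardy {v v' : ℝ → ℝ} (hd : ∀ x, HasDerivAt v (v' x) x) (hc : Continuous v')
    (i1 : Integrable (fun x => v' x ^ 2)) (i2 : Integrable (fun x => om x * v x ^ 2))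
    (h0 : v 0 = 0) :
    (∫ x, v' x ^ 2) + (∫ x, om x * v x ^ 2) ≤
      8 * ∫ x, (v' x ^ 2 + om x * (1 - 3 * φ x ^ 2) * v x ^ 2) := by
  have hv : Continuous v := continuous_iff_continuousAt.2 fun x => (hd x).continuousAt
  have ocont := om_cont
  have pcont := phi_cont
  have ig : Integrable (fun x => (v' x - om x * v x) ^ 2) := by
    refine ((i1.const_mul 2).add (i2.const_mul 2)).mono' (by fun_prop)
      (Filter.Eventually.of_forall fun x => ?_)
    have := om_pos x; have := om_lt_one x
    rw [Real.norm_eq_abs, abs_of_nonneg (sq_nonneg _)]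
    simp only [Pi.add_apply]
    have h1 : (om x * v x) ^ 2 ≤ om x * v x ^ 2 := by
      rw [mul_pow]; gcongr; nlinarith
    nlinarith [sq_nonneg (v' x + om x * v x)]
  -- the total derivative
  have iF : Integrable (fun x => -(2 * φ x ^ 2 * om x) * v x ^ 2 + om x * (2 * v x * v' x)) := by
    refine ((i1.const_mul 1).add (i2.const_mul 3)).mono' (by fun_prop)
      (Filter.Eventually.of_forall fun x => ?_)
    have o1 := om_pos x; have o2 := om_lt_one x
    have p1 := phi_pos x; have p2 := phi_lt_one x
    simp only [Pi.add_apply]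
    have hp : φ x ^ 2 ≤ 1 := by nlinarith
    have hp0 : 0 ≤ φ x ^ 2 := by positivity
    have a1 : 0 ≤ om x * v x ^ 2 := by positivity
    have a2 : om x * v' x ^ 2 ≤ v' x ^ 2 := by nlinarith [sq_nonneg (v' x)]
    have a3 : φ x ^ 2 * (om x * v x ^ 2) ≤ om x * v x ^ 2 := by nlinarith
    have a4 : 0 ≤ φ x ^ 2 * (om x * v x ^ 2) := by positivity
    have a5 : 0 ≤ om x * (v x + v' x) ^ 2 := by positivity
    have a6 : 0 ≤ om x * (v x - v' x) ^ 2 := by positivity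
    rw [Real.norm_eq_abs, abs_le]
    constructor <;> nlinarith
  have z : ∫ x, (-(2 * φ x ^ 2 * om x) * v x ^ 2 + om x * (2 * v x * v' x)) = 0 := by
    refine integral_eq_zero_of_hasDerivAt_of_integrable (f := fun x => om x * v x ^ 2)
      (fun x => ?_) iF i2
    exact ((om_hasDerivAt x).mul ((hd x).pow 2)).congr_deriv (by simp)
  have e1 : ∫ x, (v' x ^ 2 + om x * (1 - 3 * φ x ^ 2) * v x ^ 2) =
      ∫ x, (v' x - om x * v x) ^ 2 := by
    rw [← add_zero (∫ x, (v' x - om x * v x) ^ 2), ← z, ← integral_add ig iF]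
    congr 1; funext x
    rw [phi_sq_eq]; ring
  -- the Hardy estimate
  have iG : Integrable (fun x => om x * v x ^ 2 - 2 * (v' x - om x * v x) ^ 2) :=
    i2.sub (ig.const_mul 2)
  have hG : ∫ x, (om x * v x ^ 2 - 2 * (v' x - om x * v x) ^ 2) ≤ 0 := by
    have hlim := intervalIntegral_tendsto_integral (l := Filter.atTop)
      (a := fun n : ℕ => -(n : ℝ)) (b := fun n : ℕ => (n : ℝ)) iG
      (Filter.tendsto_neg_atTop_atBot.comp tendsto_natCast_atTop_atTop)
      tendsto_natCast_atTop_atTop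
    refine le_of_tendsto hlim (Filter.Eventually.of_forall fun n => ?_)
    have hn : (0 : ℝ) ≤ n := by positivity
    rw [← intervalIntegral.integral_add_adjacent_intervals (b := 0)
      iG.intervalIntegrable iG.intervalIntegrable]
    have hl : ∫ x in (-(n : ℝ))..0, (om x * v x ^ 2 - 2 * (v' x - om x * v x) ^ 2) ≤
        v 0 ^ 2 - v (-(n : ℝ)) ^ 2 := by
      refine intervalIntegral.integral_le_sub_of_hasDeriv_right_of_le
        (g := fun x => v x ^ 2) (g' := fun x => 2 * v x * v' x) (by linarith)
        (hv.pow 2).continuousOn (fun x _ => ?_) iG.integrableOn (fun x hx => ?_)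
      · exact (((hd x).pow 2).congr_deriv (by simp)).hasDerivWithinAt
      · have hx0 : om 0 ≤ om x := om_anti hx.2.le
        have : om 0 = 1 / 2 := by rw [om, phi_zero_sq]; norm_num
        have o1 := om_lt_one x
        have hb : v x ^ 2 ≤ 2 * (om x * v x ^ 2) := by nlinarith [sq_nonneg (v x)]
        nlinarith [sq_nonneg (v x + 2 * (v' x - om x * v x))]
    have hr : ∫ x in (0 : ℝ)..n, (om x * v x ^ 2 - 2 * (v' x - om x * v x) ^ 2) ≤
        (1 - 1 / φ (n : ℝ) ^ 2) * v n ^ 2 - (1 - 1 / φ 0 ^ 2) * v 0 ^ 2 := by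
      refine intervalIntegral.integral_le_sub_of_hasDeriv_right_of_le
        (g := fun x => (1 - 1 / φ x ^ 2) * v x ^ 2)
        (g' := fun x => (2 * om x / φ x ^ 2) * v x ^ 2 + (1 - 1 / φ x ^ 2) * (2 * v x * v' x))
        (by linarith) ?_ (fun x _ => ?_) iG.integrableOn (fun x hx => ?_)
      · refine Continuous.continuousOn ?_
        refine (continuous_const.sub (continuous_const.div (pcont.pow 2) fun x => ?_)).mul
          (hv.pow 2)
        exact (pow_pos (phi_pos x) 2).ne'
      · have p1 := phi_pos x
        have h1 := ((((phi_hasDerivAt x).pow 2).inv (pow_pos (phi_pos x) 2).ne').const_sub 1).mul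
          ((hd x).pow 2)
        have h3 : (fun x => (1 - 1 / φ x ^ 2) * v x ^ 2) =
            ((fun x => 1 - (φ ^ 2)⁻¹ x) * v ^ 2) := by
          funext y; simp
        rw [h3]
        refine (h1.congr_deriv ?_).hasDerivWithinAt
        simp only [Pi.inv_apply, Pi.pow_apply]
        push_cast
        field_simp
      · have hx0 : om x ≤ om 0 := om_anti hx.1.le
        have ho : om 0 = 1 / 2 := by rw [om, phi_zero_sq]; norm_num
        have o1 := om_pos x
        have p1 := phi_pos x
        have hpe := phi_sq_eq x
        set q := φ x ^ 2 with hq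
        have hq1 : 1 / 2 ≤ q := by linarith
        have e : (2 * om x / q) * v x ^ 2 + (1 - 1 / q) * (2 * v x * v' x) -
            (om x * v x ^ 2 - 2 * (v' x - om x * v x) ^ 2) =
            om x * (v x - (v' x - om x * v x) / q) ^ 2 +
              (2 - om x / q ^ 2) * (v' x - om x * v x) ^ 2 := by
          have : om x = 1 - q := by linarith
          rw [this]
          have hq0 : q ≠ 0 := by linarith
          field_simp
          ring
        have h2 : om x / q ^ 2 ≤ 2 := by
          rw [div_le_iff₀ (by positivity)]; nlinarith
        have : 0 ≤ om x * (v x - (v' x - om x * v x) / q) ^ 2 +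
              (2 - om x / q ^ 2) * (v' x - om x * v x) ^ 2 := by
          have := sub_nonneg.2 h2
          positivity
        linarith
    have hneg : (1 - 1 / φ (n : ℝ) ^ 2) * v n ^ 2 ≤ 0 := by
      have p1 := phi_pos n; have p2 := phi_lt_one n
      have : 1 ≤ 1 / φ (n : ℝ) ^ 2 := by
        rw [le_div_iff₀ (by positivity)]; nlinarith
      nlinarith [sq_nonneg (v n)]
    rw [h0] at hl hr
    nlinarith [sq_nonneg (v (-(n : ℝ)))]
  rw [integral_sub i2 (ig.const_mul 2), integral_const_mul] at hG
  have h6 : ∫ x, v' x ^ 2 ≤ 2 * (∫ x, (v' x - om x * v x) ^ 2) + 2 * ∫ x, om x * v x ^ 2 := by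
    rw [← integral_const_mul, ← integral_const_mul,
      ← integral_add (ig.const_mul 2) (i2.const_mul 2)]
    refine integral_mono i1 ((ig.const_mul 2).add (i2.const_mul 2)) fun x => ?_
    have := om_pos x; have := om_lt_one x
    have h1 : (om x * v x) ^ 2 ≤ om x * v x ^ 2 := by
      rw [mul_pow]; gcongr; nlinarith
    simp only
    nlinarith [sq_nonneg (v' x - 2 * om x * v x)]
  rw [e1]
  linarith
end

section
open Real MeasureTheory Set ENNReal

/-! ### Admissible profiles and the energy expansion -/

/-- Admissible profiles. -/
structure Adm (R : ℝ) (χ : ℝ → ℂ) : Prop where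
  smooth : ContDiff ℝ 1 χ
  i1 : Integrable (fun x => ‖deriv χ x - (dphi x : ℂ)‖ ^ 2)
  i2 : Integrable (fun x => om x * ‖χ x - (φ x : ℂ)‖ ^ 2)
  i3 : IntegrableOn (fun x => (‖χ x‖ ^ 2 - φ x ^ 2) ^ 2) (Ioi R)

noncomputable def N1 (χ : ℝ → ℂ) : ℝ := ∫ x, ‖deriv χ x - (dphi x : ℂ)‖ ^ 2
noncomputable def N2 (χ : ℝ → ℂ) : ℝ := ∫ x, om x * ‖χ x - (φ x : ℂ)‖ ^ 2
noncomputable def N3 (R : ℝ) (χ : ℝ → ℂ) : ℝ := ∫ x in Ioi R, (‖χ x‖ ^ 2 - φ x ^ 2) ^ 2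
noncomputable def rr (R : ℝ) (χ : ℝ → ℂ) : ℝ := N1 χ + N2 χ + N3 R χ

lemma N1_nonneg (χ : ℝ → ℂ) : 0 ≤ N1 χ := integral_nonneg fun x => by positivity
lemma N2_nonneg (χ : ℝ → ℂ) : 0 ≤ N2 χ :=
  integral_nonneg fun x => by have := om_pos x; positivity
lemma N3_nonneg (R : ℝ) (χ : ℝ → ℂ) : 0 ≤ N3 R χ := integral_nonneg fun x => by positivity

/-- Real and imaginary parts of the perturbation. -/
noncomputable def uu (χ : ℝ → ℂ) (x : ℝ) : ℝ := (χ x).re - φ x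
noncomputable def vv (χ : ℝ → ℂ) (x : ℝ) : ℝ := (χ x).im
noncomputable def du (χ : ℝ → ℂ) (x : ℝ) : ℝ := (deriv χ x).re - dphi x
noncomputable def dv (χ : ℝ → ℂ) (x : ℝ) : ℝ := (deriv χ x).im
noncomputable def eta (χ : ℝ → ℂ) (x : ℝ) : ℝ := ‖χ x‖ ^ 2 - φ x ^ 2

lemma normsq (z : ℂ) : ‖z‖ ^ 2 = z.re ^ 2 + z.im ^ 2 := by
  rw [Complex.sq_norm, Complex.normSq_apply]; ring

lemma w_sq (χ : ℝ → ℂ) (x : ℝ) : ‖χ x - (φ x : ℂ)‖ ^ 2 = uu χ x ^ 2 + vv χ x ^ 2 := by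
  rw [normsq]; simp [uu, vv]

lemma dw_sq (χ : ℝ → ℂ) (x : ℝ) :
    ‖deriv χ x - (dphi x : ℂ)‖ ^ 2 = du χ x ^ 2 + dv χ x ^ 2 := by
  rw [normsq]; simp [du, dv]

lemma eta_eq (χ : ℝ → ℂ) (x : ℝ) :
    eta χ x = 2 * φ x * uu χ x + (uu χ x ^ 2 + vv χ x ^ 2) := by
  rw [eta, normsq]; simp only [uu, vv]; ring

/-- The quadratic-and-higher part of the energy density. -/
noncomputable def DD (χ : ℝ → ℂ) (x : ℝ) : ℝ :=
  du χ x ^ 2 + dv χ x ^ 2 + om x * (1 - 3 * φ x ^ 2) * (uu χ x ^ 2 + vv χ x ^ 2)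
    + (3 * φ x ^ 2 - 2) * eta χ x ^ 2 + eta χ x ^ 3

lemma density_eq (χ : ℝ → ℂ) (x : ℝ) :
    ‖deriv χ x‖ ^ 2 + ‖χ x‖ ^ 2 * (1 - ‖χ x‖ ^ 2) ^ 2 =
      2 * dphi x ^ 2 + (2 * (dphi x * (1 - 3 * φ x ^ 2) * uu χ x + dphi x * du χ x) + DD χ x) := by
  rw [DD, eta_eq, normsq, normsq]
  have h1 : (χ x).re = uu χ x + φ x := by simp [uu]
  have h2 : (χ x).im = vv χ x := rfl
  have h3 : (deriv χ x).re = du χ x + dphi x := by simp [du]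
  have h4 : (deriv χ x).im = dv χ x := rfl
  rw [h1, h2, h3, h4]
  simp only [dphi, om]
  ring

section adm
variable {R : ℝ} {χ : ℝ → ℂ}

lemma Adm.hasDeriv (h : Adm R χ) (x : ℝ) : HasDerivAt χ (deriv χ x) x :=
  ((h.smooth.differentiable (by norm_num)) x).hasDerivAt

lemma Adm.contD (h : Adm R χ) : Continuous (deriv χ) :=
  h.smooth.continuous_deriv (by norm_num)

lemma Adm.cont (h : Adm R χ) : Continuous χ := h.smooth.continuous

lemma Adm.uu_deriv (h : Adm R χ) (x : ℝ) : HasDerivAt (uu χ) (du χ x) x := by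
  have h1 := (Complex.reCLM.hasFDerivAt.comp_hasDerivAt x (h.hasDeriv x))
  exact h1.sub (phi_hasDerivAt x)

lemma Adm.vv_deriv (h : Adm R χ) (x : ℝ) : HasDerivAt (vv χ) (dv χ x) x :=
  (Complex.imCLM.hasFDerivAt.comp_hasDerivAt x (h.hasDeriv x))

lemma Adm.du_cont (h : Adm R χ) : Continuous (du χ) :=
  (Complex.continuous_re.comp h.contD).sub dphi_cont
lemma Adm.dv_cont (h : Adm R χ) : Continuous (dv χ) := Complex.continuous_im.comp h.contD
lemma Adm.uu_cont (h : Adm R χ) : Continuous (uu χ) :=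
  (Complex.continuous_re.comp h.cont).sub phi_cont
lemma Adm.vv_cont (h : Adm R χ) : Continuous (vv χ) := Complex.continuous_im.comp h.cont
lemma Adm.eta_cont (h : Adm R χ) : Continuous (eta χ) :=
  (h.cont.norm.pow 2).sub (phi_cont.pow 2)
lemma Adm.DD_cont (h : Adm R χ) : Continuous (DD χ) := by
  have := h.du_cont; have := h.dv_cont; have := h.uu_cont; have := h.vv_cont
  have := h.eta_cont; have := om_cont; have := phi_cont
  unfold DD
  fun_prop

lemma Adm.du_int (h : Adm R χ) : Integrable (fun x => du χ x ^ 2) := by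
  refine h.i1.mono' (h.du_cont.pow 2).aestronglyMeasurable
    (Filter.Eventually.of_forall fun x => ?_)
  rw [Real.norm_eq_abs, abs_of_nonneg (sq_nonneg _), dw_sq]
  nlinarith [sq_nonneg (dv χ x)]
lemma Adm.dv_int (h : Adm R χ) : Integrable (fun x => dv χ x ^ 2) := by
  refine h.i1.mono' (h.dv_cont.pow 2).aestronglyMeasurable
    (Filter.Eventually.of_forall fun x => ?_)
  rw [Real.norm_eq_abs, abs_of_nonneg (sq_nonneg _), dw_sq]
  nlinarith [sq_nonneg (du χ x)]
lemma Adm.uu_int (h : Adm R χ) : Integrable (fun x => om x * uu χ x ^ 2) := by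
  refine h.i2.mono' (om_cont.mul (h.uu_cont.pow 2)).aestronglyMeasurable
    (Filter.Eventually.of_forall fun x => ?_)
  have := om_pos x
  rw [Real.norm_eq_abs, abs_of_nonneg (by positivity), w_sq]
  gcongr
  nlinarith [sq_nonneg (vv χ x)]
lemma Adm.vv_int (h : Adm R χ) : Integrable (fun x => om x * vv χ x ^ 2) := by
  refine h.i2.mono' (om_cont.mul (h.vv_cont.pow 2)).aestronglyMeasurable
    (Filter.Eventually.of_forall fun x => ?_)
  have := om_pos x
  rw [Real.norm_eq_abs, abs_of_nonneg (by positivity), w_sq]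
  gcongr
  nlinarith [sq_nonneg (uu χ x)]

lemma Adm.N1_eq (h : Adm R χ) : N1 χ = (∫ x, du χ x ^ 2) + ∫ x, dv χ x ^ 2 := by
  rw [N1, ← integral_add h.du_int h.dv_int]
  simp only [dw_sq]
lemma Adm.N2_eq (h : Adm R χ) : N2 χ = (∫ x, om x * uu χ x ^ 2) + ∫ x, om x * vv χ x ^ 2 := by
  rw [N2, ← integral_add h.uu_int h.vv_int]
  simp only [w_sq, mul_add]

lemma Adm.dphi_uu_int (h : Adm R χ) : Integrable (fun x => dphi x * uu χ x) := by
  refine (h.uu_int.add phi_dphi_int).mono' (dphi_cont.mul h.uu_cont).aestronglyMeasurable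
    (Filter.Eventually.of_forall fun x => ?_)
  have o := om_pos x
  simp only [Pi.add_apply]
  rw [Real.norm_eq_abs, dphi, abs_le]
  have a1 : 0 ≤ om x * (uu χ x + φ x) ^ 2 := by positivity
  have a2 : 0 ≤ om x * (uu χ x - φ x) ^ 2 := by positivity
  have a3 : 0 ≤ om x * uu χ x ^ 2 := by positivity
  have a4 : 0 ≤ om x * φ x ^ 2 := by positivity
  constructor <;> nlinarith

lemma Adm.lin_int (h : Adm R χ) :
    Integrable (fun x => dphi x * (1 - 3 * φ x ^ 2) * uu χ x + dphi x * du χ x) := by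
  have c1 := dphi_cont; have c2 := phi_cont; have c3 := h.uu_cont; have c4 := h.du_cont
  refine Integrable.add ?_ ?_
  · refine (h.dphi_uu_int.norm.const_mul 2).mono' (by fun_prop)
      (Filter.Eventually.of_forall fun x => ?_)
    have p := phi_sq_eq x
    have o1 := om_pos x; have o2 := om_lt_one x
    simp only [Real.norm_eq_abs, abs_mul]
    have : |1 - 3 * φ x ^ 2| ≤ 2 := by rw [abs_le]; constructor <;> linarith
    nlinarith [mul_nonneg (abs_nonneg (dphi x)) (abs_nonneg (uu χ x))]
  · refine (dphi_sq_int.add h.du_int).mono' (by fun_prop)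
      (Filter.Eventually.of_forall fun x => ?_)
    simp only [Pi.add_apply]
    rw [Real.norm_eq_abs, abs_le]
    constructor <;> nlinarith [sq_nonneg (dphi x + du χ x), sq_nonneg (dphi x - du χ x)]

lemma Adm.lin_zero (h : Adm R χ) :
    ∫ x, (dphi x * (1 - 3 * φ x ^ 2) * uu χ x + dphi x * du χ x) = 0 :=
  integral_eq_zero_of_hasDerivAt_of_integrable
    (fun x => (dphi_hasDerivAt x).mul (h.uu_deriv x)) h.lin_int h.dphi_uu_int

/-- The energy of the kink. -/
noncomputable def E0 : ℝ := ∫ x, 2 * dphi x ^ 2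

lemma Adm.energy_eq (h : Adm R χ) (hD : Integrable (DD χ)) :
    energy χ = ENNReal.ofReal (E0 + ∫ x, DD χ x) ∧ 0 ≤ E0 + ∫ x, DD χ x := by
  have i : Integrable (fun x => ‖deriv χ x‖ ^ 2 + ‖χ x‖ ^ 2 * (1 - ‖χ x‖ ^ 2) ^ 2) := by
    simp only [density_eq]
    exact (dphi_sq_int.const_mul 2).add ((h.lin_int.const_mul 2).add hD)
  have hn : ∀ x, 0 ≤ ‖deriv χ x‖ ^ 2 + ‖χ x‖ ^ 2 * (1 - ‖χ x‖ ^ 2) ^ 2 :=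
    fun x => by positivity
  have e : ∫ x, (‖deriv χ x‖ ^ 2 + ‖χ x‖ ^ 2 * (1 - ‖χ x‖ ^ 2) ^ 2) = E0 + ∫ x, DD χ x := by
    simp only [density_eq]
    have i2 : Integrable (fun x => 2 * (dphi x * (1 - 3 * φ x ^ 2) * uu χ x + dphi x * du χ x)) :=
      h.lin_int.const_mul 2
    have i3 : Integrable (fun x => 2 * (dphi x * (1 - 3 * φ x ^ 2) * uu χ x + dphi x * du χ x)
      + DD χ x) := i2.add hD
    rw [integral_add (dphi_sq_int.const_mul 2) i3, integral_add i2 hD, integral_const_mul 2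
      (fun x => dphi x * (1 - 3 * φ x ^ 2) * uu χ x + dphi x * du χ x), h.lin_zero, E0]
    ring
  rw [← e]
  refine ⟨?_, integral_nonneg hn⟩
  rw [energy, ofReal_integral_eq_lintegral_ofReal i (Filter.Eventually.of_forall hn)]

/-- Pointwise upper bound. -/
lemma DD_abs_le (hw : ∀ x ≤ R, ‖χ x - (φ x : ℂ)‖ ≤ 1) (he : ∀ x > R, |eta χ x| ≤ 1) (x : ℝ) :
    |DD χ x| ≤ ‖deriv χ x - (dphi x : ℂ)‖ ^ 2 + (2 + 45 / om R) * (om x * ‖χ x - (φ x : ℂ)‖ ^ 2)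
      + 3 * (Ioi R).indicator (fun x => (‖χ x‖ ^ 2 - φ x ^ 2) ^ 2) x := by
  have oR := om_pos R
  have o1 := om_pos x; have o2 := om_lt_one x
  have p := phi_sq_eq x
  have pp := phi_pos x; have p1 := phi_lt_one x
  have hb : |om x * (1 - 3 * φ x ^ 2) * (uu χ x ^ 2 + vv χ x ^ 2)| ≤
      2 * (om x * (uu χ x ^ 2 + vv χ x ^ 2)) := by
    rw [abs_mul, abs_mul, abs_of_pos o1, abs_of_nonneg (by positivity : 0 ≤ uu χ x ^ 2 + vv χ x ^ 2)]
    have : |1 - 3 * φ x ^ 2| ≤ 2 := by rw [abs_le]; constructor <;> linarith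
    have h3 : 0 ≤ om x * (uu χ x ^ 2 + vv χ x ^ 2) := by positivity
    nlinarith
  have hc : |3 * φ x ^ 2 - 2| ≤ 2 := by rw [abs_le]; constructor <;> linarith
  have hd : |(3 * φ x ^ 2 - 2) * eta χ x ^ 2| ≤ 2 * eta χ x ^ 2 := by
    rw [abs_mul, abs_of_nonneg (sq_nonneg (eta χ x))]
    gcongr
  have hab : |DD χ x| ≤ (du χ x ^ 2 + dv χ x ^ 2) + 2 * (om x * (uu χ x ^ 2 + vv χ x ^ 2)) +
      2 * eta χ x ^ 2 + |eta χ x| * eta χ x ^ 2 := by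
    have he3 : |eta χ x ^ 3| = |eta χ x| * eta χ x ^ 2 := by
      rw [pow_succ, abs_mul, abs_of_nonneg (sq_nonneg (eta χ x))]; ring
    unfold DD
    refine (abs_add_le _ _).trans ?_
    rw [he3]
    gcongr
    refine (abs_add_le _ _).trans ?_
    gcongr
    refine (abs_add_le _ _).trans ?_
    gcongr
    rw [abs_of_nonneg (by positivity)]
  rw [dw_sq, w_sq]
  by_cases hx : x ≤ R
  · rw [indicator_of_notMem (by simpa using hx)]
    have hw' := hw x hx
    have hws := w_sq χ x
    set s := uu χ x ^ 2 + vv χ x ^ 2 with hs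
    set n := ‖χ x - (φ x : ℂ)‖ with hn
    have n0 : 0 ≤ n := norm_nonneg _
    have hu : |uu χ x| ≤ n := by
      refine abs_le_of_sq_le_sq ?_ n0
      rw [hws, hs]; nlinarith [sq_nonneg (vv χ x)]
    have heta : |eta χ x| ≤ 3 * n := by
      rw [eta_eq]
      refine (abs_add_le _ _).trans ?_
      rw [abs_mul, abs_of_pos (by positivity : 0 < 2 * φ x), ← hs, ← hws,
        abs_of_nonneg (sq_nonneg n)]
      nlinarith [abs_nonneg (uu χ x)]
    have hes : eta χ x ^ 2 ≤ 9 * s := by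
      rw [← hws, ← sq_abs]; nlinarith [abs_nonneg (eta χ x)]
    have hos : om R ≤ om x := om_anti hx
    have s0 : 0 ≤ s := by positivity
    have h45 : 45 * s ≤ 45 / om R * (om x * s) := by
      rw [div_mul_eq_mul_div, le_div_iff₀ oR]
      nlinarith
    have h3 : |eta χ x| * eta χ x ^ 2 ≤ 3 * eta χ x ^ 2 := by
      have : |eta χ x| ≤ 3 := by linarith
      gcongr
    nlinarith
  · rw [indicator_of_mem (by simpa using hx)]
    have he' := he x (by linarith)
    have h3 : |eta χ x| * eta χ x ^ 2 ≤ 1 * eta χ x ^ 2 := by gcongr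
    have h4 : 0 ≤ 45 / om R * (om x * (uu χ x ^ 2 + vv χ x ^ 2)) := by positivity
    have : (‖χ x‖ ^ 2 - φ x ^ 2) ^ 2 = eta χ x ^ 2 := rfl
    nlinarith

lemma Adm.ind_int (h : Adm R χ) :
    Integrable ((Ioi R).indicator (fun x => (‖χ x‖ ^ 2 - φ x ^ 2) ^ 2)) :=
  h.i3.integrable_indicator measurableSet_Ioi

lemma Adm.N3_eq (χ : ℝ → ℂ) :
    N3 R χ = ∫ x, (Ioi R).indicator (fun x => (‖χ x‖ ^ 2 - φ x ^ 2) ^ 2) x := by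
  rw [N3, integral_indicator measurableSet_Ioi]

lemma Adm.DD_int (h : Adm R χ) (hw : ∀ x ≤ R, ‖χ x - (φ x : ℂ)‖ ≤ 1)
    (he : ∀ x > R, |eta χ x| ≤ 1) : Integrable (DD χ) := by
  refine ((h.i1.add (h.i2.const_mul (2 + 45 / om R))).add (h.ind_int.const_mul 3)).mono'
    h.DD_cont.aestronglyMeasurable (Filter.Eventually.of_forall fun x => ?_)
  exact DD_abs_le hw he x

/-- Upper bound of the energy. -/
lemma Adm.DD_upper (h : Adm R χ) (hw : ∀ x ≤ R, ‖χ x - (φ x : ℂ)‖ ≤ 1)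
    (he : ∀ x > R, |eta χ x| ≤ 1) : ∫ x, DD χ x ≤ (3 + 45 / om R) * rr R χ := by
  have i12 : Integrable (fun x => ‖deriv χ x - (dphi x : ℂ)‖ ^ 2 +
    (2 + 45 / om R) * (om x * ‖χ x - (φ x : ℂ)‖ ^ 2)) := h.i1.add (h.i2.const_mul (2 + 45 / om R))
  have h1 : ∫ x, DD χ x ≤ ∫ x, (‖deriv χ x - (dphi x : ℂ)‖ ^ 2 +
      (2 + 45 / om R) * (om x * ‖χ x - (φ x : ℂ)‖ ^ 2)
      + 3 * (Ioi R).indicator (fun x => (‖χ x‖ ^ 2 - φ x ^ 2) ^ 2) x) :=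
    integral_mono (h.DD_int hw he) (i12.add (h.ind_int.const_mul 3))
      fun x => (le_abs_self _).trans (DD_abs_le hw he x)
  rw [integral_add i12 (h.ind_int.const_mul 3), integral_add h.i1 (h.i2.const_mul _),
    integral_const_mul, integral_const_mul, ← Adm.N3_eq] at h1
  change _ ≤ N1 χ + (2 + 45 / om R) * N2 χ + 3 * N3 R χ at h1
  have oR := om_pos R
  have a := N1_nonneg χ; have b := N2_nonneg χ; have c := N3_nonneg R χ
  have d : 0 ≤ 45 / om R := by positivity
  rw [rr]
  nlinarith [mul_nonneg d a, mul_nonneg d c]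

end adm
end

section
open Real MeasureTheory Set ENNReal

/-! ### Lower bound of the energy -/

lemma om_le_W (R x : ℝ) : om x ≤ W R x := by
  unfold W
  split_ifs with h
  · exact (om_lt_one x).le
  · change om x ≤ om x / om R
    rw [le_div_iff₀ (om_pos R)]
    nlinarith [om_pos x, om_lt_one R]

lemma W_le (R x : ℝ) : W R x ≤ om x / om R := by
  unfold W
  split_ifs with h
  · rw [le_div_iff₀ (om_pos R), one_mul]; exact om_anti h
  · exact le_rfl

lemma W_meas (R : ℝ) : Measurable (W R) := by
  unfold W
  refine Measurable.ite measurableSet_Iic measurable_const ?_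
  exact ((measurable_const.sub (phi_cont.measurable.pow_const 2))).div_const _

lemma W_pos (R x : ℝ) : 0 < W R x := (om_pos x).trans_le (om_le_W R x)

/-- The potential in the quadratic form `Q_R`. -/
noncomputable def VV (R x : ℝ) : ℝ :=
  if x ≤ R then 1 - 12 * (φ x) ^ 2 + 15 * (φ x) ^ 4 else 1 - 4 * (φ x) ^ 2 + 3 * (φ x) ^ 4

lemma VV_meas (R : ℝ) : Measurable (VV R) := by
  unfold VV
  have := phi_cont.measurable
  refine Measurable.ite measurableSet_Iic ?_ ?_ <;> fun_prop

lemma VV_le (R x : ℝ) : |VV R x| ≤ 28 / om R * om x := by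
  have oR := om_pos R; have oR1 := om_lt_one R
  have o1 := om_pos x; have o2 := om_lt_one x
  have p := phi_sq_eq x
  have p4 : φ x ^ 4 = (1 - om x) ^ 2 := by rw [← p]; ring
  have h28 : 28 ≤ 28 / om R := by rw [le_div_iff₀ oR]; linarith
  unfold VV
  split_ifs with h
  · have ho := om_anti h
    have : 28 ≤ 28 / om R * om x := by
      rw [div_mul_eq_mul_div, le_div_iff₀ oR]; linarith
    refine le_trans ?_ this
    rw [p, p4, abs_le]
    constructor <;> nlinarith
  · have : 28 * om x ≤ 28 / om R * om x := by gcongr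
    refine le_trans ?_ this
    rw [p, p4, abs_le]
    constructor <;> nlinarith

lemma lower_arith {c1 C P κ k A1 A2 B1 B2 WU Q L n3 D : ℝ} (hc1 : 0 < c1) (hC : c1 ≤ C)
    (h8 : c1 ≤ 1 / 8) (hP : 0 < P) (hκ : κ ≤ P / 2) (hk : k ≤ c1 / 2)
    (a1 : 0 ≤ A1) (a2 : 0 ≤ A2) (b1 : 0 ≤ B1) (b2 : 0 ≤ B2) (n : 0 ≤ n3) (hW : B1 ≤ WU)
    (hQ : C * (A1 + WU) ≤ Q) (hL : A2 + B2 ≤ 8 * L)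
    (hD : Q + L + (P - κ) * n3 - k * (B1 + B2) ≤ D) :
    min (c1 / 2) (P / 2) * (A1 + A2 + (B1 + B2) + n3) ≤ D := by
  have c1' : c1 * (A1 + B1) ≤ Q := le_trans (by gcongr; linarith) hQ
  have c2 : c1 * (A2 + B2) ≤ 1 / 8 * (A2 + B2) := by gcongr
  have b4 : k * (B1 + B2) ≤ c1 / 2 * (B1 + B2) := by gcongr
  have b5 : P / 2 * n3 ≤ (P - κ) * n3 := by gcongr; linarith
  have m1 : min (c1 / 2) (P / 2) * (A1 + A2 + (B1 + B2)) ≤ c1 / 2 * (A1 + A2 + (B1 + B2)) := by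
    gcongr; exact min_le_left _ _
  have m2 : min (c1 / 2) (P / 2) * n3 ≤ P / 2 * n3 := by
    gcongr; exact min_le_right _ _
  have m3 : 0 ≤ c1 * A1 := by positivity
  have m4 : 0 ≤ c1 * A2 := by positivity
  linarith

section lower
variable {R : ℝ} {χ : ℝ → ℂ}

lemma DD_ge {κ : ℝ} (k1 : κ ≤ 1)
    (hw : ∀ x ≤ R, ‖χ x - (φ x : ℂ)‖ ≤ κ) (he : ∀ x > R, |eta χ x| ≤ κ) (k0 : 0 ≤ κ) (x : ℝ) :
    (du χ x ^ 2 + VV R x * uu χ x ^ 2) + (dv χ x ^ 2 + om x * (1 - 3 * φ x ^ 2) * vv χ x ^ 2)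
      + (3 * φ R ^ 2 - 2 - κ) * (Ioi R).indicator (fun x => (‖χ x‖ ^ 2 - φ x ^ 2) ^ 2) x
      - (37 * κ / om R) * (om x * ‖χ x - (φ x : ℂ)‖ ^ 2) ≤ DD χ x := by
  have oR := om_pos R
  have o1 := om_pos x; have o2 := om_lt_one x
  have p := phi_sq_eq x
  have pp := phi_pos x; have p1 := phi_lt_one x
  have hom : om x = 1 - φ x ^ 2 := rfl
  by_cases hx : x ≤ R
  · rw [indicator_of_notMem (by simpa using hx)]
    have hw' := hw x hx
    have hws := w_sq χ x
    have hV : VV R x = om x * (1 - 3 * φ x ^ 2) + 4 * φ x ^ 2 * (3 * φ x ^ 2 - 2) := by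
      rw [VV, if_pos hx, hom]; ring
    rw [hV, DD]
    set s := uu χ x ^ 2 + vv χ x ^ 2 with hs
    set n := ‖χ x - (φ x : ℂ)‖ with hn
    have n0 : 0 ≤ n := norm_nonneg _
    have hu : |uu χ x| ≤ n := by
      refine abs_le_of_sq_le_sq ?_ n0
      rw [hws, hs]; nlinarith [sq_nonneg (vv χ x)]
    have heta : |eta χ x| ≤ 3 * n := by
      rw [eta_eq]
      refine (abs_add_le _ _).trans ?_
      rw [abs_mul, abs_of_pos (by positivity : 0 < 2 * φ x), ← hs, ← hws,
        abs_of_nonneg (sq_nonneg n)]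
      nlinarith [abs_nonneg (uu χ x)]
    have s0 : 0 ≤ s := by positivity
    have hes : eta χ x ^ 2 ≤ 9 * s := by
      rw [← hws, ← sq_abs]; nlinarith [abs_nonneg (eta χ x)]
    have hos : om R ≤ om x := om_anti hx
    have h37 : 37 * κ * s ≤ 37 * κ / om R * (om x * s) := by
      rw [div_mul_eq_mul_div, le_div_iff₀ oR]
      have : 0 ≤ 37 * κ * s := by positivity
      nlinarith
    have he3 : -(27 * κ * s) ≤ eta χ x ^ 3 := by
      have a : |eta χ x ^ 3| ≤ 27 * κ * s := by
        have : |eta χ x ^ 3| = |eta χ x| * eta χ x ^ 2 := by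
          rw [pow_succ, abs_mul, abs_of_nonneg (sq_nonneg (eta χ x))]; ring
        rw [this]
        calc |eta χ x| * eta χ x ^ 2 ≤ (3 * κ) * (9 * s) := by
              gcongr; linarith
          _ = 27 * κ * s := by ring
      exact (abs_le.1 a).1
    have hsk : s ≤ κ := by rw [← hws]; nlinarith
    have hq : |eta χ x ^ 2 - 4 * φ x ^ 2 * uu χ x ^ 2| ≤ 5 * κ * s := by
      have e : eta χ x ^ 2 - 4 * φ x ^ 2 * uu χ x ^ 2 = (4 * φ x * uu χ x + s) * s := by
        rw [eta_eq, ← hs]; ring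
      rw [e, abs_mul, abs_of_nonneg s0]
      gcongr
      refine (abs_add_le _ _).trans ?_
      rw [abs_mul, abs_of_pos (by positivity : 0 < 4 * φ x), abs_of_nonneg s0]
      nlinarith [abs_nonneg (uu χ x)]
    have hc : |3 * φ x ^ 2 - 2| ≤ 2 := by rw [abs_le]; constructor <;> linarith
    have hq2 : |(3 * φ x ^ 2 - 2) * (eta χ x ^ 2 - 4 * φ x ^ 2 * uu χ x ^ 2)| ≤ 10 * κ * s := by
      rw [abs_mul]
      calc _ ≤ 2 * (5 * κ * s) := by gcongr
        _ = _ := by ring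
    have hq3 := (abs_le.1 hq2).1
    rw [hws]
    nlinarith
  · rw [indicator_of_mem (by simpa using hx)]
    have hx' : R < x := by linarith
    have he' := he x hx'
    have hV : VV R x = om x * (1 - 3 * φ x ^ 2) := by
      rw [VV, if_neg hx, hom]; ring
    have hP : φ R ^ 2 ≤ φ x ^ 2 := by
      have := phi_mono hx'; have := phi_pos R; nlinarith
    have : (‖χ x‖ ^ 2 - φ x ^ 2) ^ 2 = eta χ x ^ 2 := rfl
    rw [hV, DD, this]
    have h3 : (3 * φ R ^ 2 - 2 - κ) * eta χ x ^ 2 ≤ (3 * φ x ^ 2 - 2 + eta χ x) * eta χ x ^ 2 := by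
      have := (abs_le.1 he').1
      gcongr
      linarith
    have h4 : 0 ≤ 37 * κ / om R * (om x * ‖χ x - (φ x : ℂ)‖ ^ 2) := by positivity
    nlinarith

set_option maxHeartbeats 1000000 in
/-- Lower bound of the energy, under the orthogonality conditions. -/
lemma energy_lower (hR : 2 / 3 < (φ R) ^ 2)
    (hcoer : ∃ C > (0 : ℝ),
      ∀ u : ℝ → ℝ, Differentiable ℝ u →
        Integrable (fun x => (deriv u x) ^ 2) →
        Integrable (fun x => W R x * (u x) ^ 2) →
        (∫ x : ℝ, u x * deriv φ x) = 0 →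
        C * ((∫ x : ℝ, (deriv u x) ^ 2) + ∫ x : ℝ, W R x * (u x) ^ 2) ≤
          (∫ x in Iic R,
            ((deriv u x) ^ 2 + (1 - 12 * (φ x) ^ 2 + 15 * (φ x) ^ 4) * (u x) ^ 2)) +
          (∫ x in Ioi R,
            ((deriv u x) ^ 2 + (1 - 4 * (φ x) ^ 2 + 3 * (φ x) ^ 4) * (u x) ^ 2))) :
    ∃ c > (0 : ℝ), ∃ κ > (0 : ℝ), κ ≤ 1 ∧ ∀ χ : ℝ → ℂ, Adm R χ → (χ 0).im = 0 →
      (∫ x, uu χ x * dphi x) = 0 →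
      (∀ x ≤ R, ‖χ x - (φ x : ℂ)‖ ≤ κ) → (∀ x > R, |eta χ x| ≤ κ) →
      c * rr R χ ≤ ∫ x, DD χ x := by
  obtain ⟨C, hC, H⟩ := hcoer
  have oR := om_pos R
  obtain ⟨c1, hc1, hc1C, hc18⟩ : ∃ c1 > 0, c1 ≤ C ∧ c1 ≤ 1 / 8 :=
    ⟨min C (1 / 8), by positivity, min_le_left _ _, min_le_right _ _⟩
  set P := 3 * φ R ^ 2 - 2 with hP
  have hP0 : 0 < P := by linarith
  obtain ⟨κ, hκ, hκ1, hκP, hκc⟩ : ∃ κ > 0, κ ≤ 1 ∧ κ ≤ P / 2 ∧ κ ≤ c1 * om R / 74 :=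
    ⟨min (min 1 (P / 2)) (c1 * om R / 74), by positivity,
      (min_le_left _ _).trans (min_le_left _ _), (min_le_left _ _).trans (min_le_right _ _),
      min_le_right _ _⟩
  refine ⟨min (c1 / 2) (P / 2), by positivity, κ, hκ, hκ1, fun χ h him horth hw he => ?_⟩
  have hw1 : ∀ x ≤ R, ‖χ x - (φ x : ℂ)‖ ≤ 1 := fun x hx => (hw x hx).trans hκ1
  have he1 : ∀ x > R, |eta χ x| ≤ 1 := fun x hx => (he x hx).trans hκ1
  have hdu : deriv (uu χ) = du χ := funext fun x => (h.uu_deriv x).deriv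
  have iW : Integrable (fun x => W R x * (uu χ x) ^ 2) := by
    refine (h.uu_int.const_mul (1 / om R)).mono'
      ((W_meas R).aestronglyMeasurable.mul (h.uu_cont.pow 2).aestronglyMeasurable)
      (Filter.Eventually.of_forall fun x => ?_)
    have := W_pos R x
    rw [Real.norm_eq_abs, abs_of_nonneg (by positivity)]
    calc W R x * uu χ x ^ 2 ≤ (om x / om R) * uu χ x ^ 2 := by gcongr; exact W_le R x
      _ = 1 / om R * (om x * uu χ x ^ 2) := by ring
  have iV : Integrable (fun x => VV R x * uu χ x ^ 2) := by
    refine (h.uu_int.const_mul (28 / om R)).mono'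
      ((VV_meas R).aestronglyMeasurable.mul (h.uu_cont.pow 2).aestronglyMeasurable)
      (Filter.Eventually.of_forall fun x => ?_)
    rw [Real.norm_eq_abs, abs_mul, abs_of_nonneg (sq_nonneg (uu χ x)), ← mul_assoc]
    gcongr
    exact VV_le R x
  have hQ := H (uu χ) (fun x => (h.uu_deriv x).differentiableAt) (by rw [hdu]; exact h.du_int) iW
    (by
      have : deriv φ = dphi := funext phi_deriv
      rw [this]; exact horth)
  rw [hdu] at hQ
  have iQ : Integrable (fun x => du χ x ^ 2 + VV R x * uu χ x ^ 2) := h.du_int.add iV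
  have eQ : (∫ x in Iic R,
            ((du χ x) ^ 2 + (1 - 12 * (φ x) ^ 2 + 15 * (φ x) ^ 4) * (uu χ x) ^ 2)) +
          (∫ x in Ioi R,
            ((du χ x) ^ 2 + (1 - 4 * (φ x) ^ 2 + 3 * (φ x) ^ 4) * (uu χ x) ^ 2)) =
      ∫ x, (du χ x ^ 2 + VV R x * uu χ x ^ 2) := by
    rw [← integral_add_compl (measurableSet_Iic (a := R)) iQ, compl_Iic]
    congr 1
    · refine setIntegral_congr_fun measurableSet_Iic fun x hx => ?_
      simp only [VV]
      rw [if_pos (mem_Iic.1 hx)]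
    · refine setIntegral_congr_fun measurableSet_Ioi fun x hx => ?_
      simp only [VV]
      rw [if_neg (not_le.2 (mem_Ioi.1 hx))]
  rw [eQ] at hQ
  have hL := hardy h.vv_deriv h.dv_cont h.dv_int h.vv_int him
  have iL : Integrable (fun x => dv χ x ^ 2 + om x * (1 - 3 * φ x ^ 2) * vv χ x ^ 2) := by
    refine h.dv_int.add ((h.vv_int.const_mul 2).mono' ?_
      (Filter.Eventually.of_forall fun x => ?_))
    · have := om_cont; have := phi_cont; have := h.vv_cont
      fun_prop
    · have p := phi_sq_eq x
      have o1 := om_pos x; have o2 := om_lt_one x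
      have : |1 - 3 * φ x ^ 2| ≤ 2 := by rw [abs_le]; constructor <;> linarith
      rw [Real.norm_eq_abs, abs_mul, abs_mul, abs_of_pos o1, abs_of_nonneg (sq_nonneg (vv χ x))]
      have : 0 ≤ om x * vv χ x ^ 2 := by positivity
      nlinarith
  have hWom : ∫ x, om x * uu χ x ^ 2 ≤ ∫ x, W R x * uu χ x ^ 2 := by
    refine integral_mono h.uu_int iW fun x => ?_
    simp only
    gcongr
    exact om_le_W R x
  have iQL : Integrable (fun x => (du χ x ^ 2 + VV R x * uu χ x ^ 2) +
      (dv χ x ^ 2 + om x * (1 - 3 * φ x ^ 2) * vv χ x ^ 2)) := iQ.add iL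
  have iI := h.ind_int.const_mul (P - κ)
  have iQLI : Integrable (fun x => (du χ x ^ 2 + VV R x * uu χ x ^ 2) +
      (dv χ x ^ 2 + om x * (1 - 3 * φ x ^ 2) * vv χ x ^ 2) +
      (P - κ) * (Ioi R).indicator (fun x => (‖χ x‖ ^ 2 - φ x ^ 2) ^ 2) x) := iQL.add iI
  have i4 := h.i2.const_mul (37 * κ / om R)
  have hlow : ∫ x, ((du χ x ^ 2 + VV R x * uu χ x ^ 2) +
      (dv χ x ^ 2 + om x * (1 - 3 * φ x ^ 2) * vv χ x ^ 2) +
      (P - κ) * (Ioi R).indicator (fun x => (‖χ x‖ ^ 2 - φ x ^ 2) ^ 2) x -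
      (37 * κ / om R) * (om x * ‖χ x - (φ x : ℂ)‖ ^ 2)) ≤ ∫ x, DD χ x :=
    integral_mono (iQLI.sub i4) (h.DD_int hw1 he1) (DD_ge hκ1 hw he hκ.le)
  rw [integral_sub iQLI i4, integral_add iQL iI, integral_add iQ iL, integral_const_mul,
    integral_const_mul, ← Adm.N3_eq] at hlow
  change _ + _ + (P - κ) * N3 R χ - 37 * κ / om R * N2 χ ≤ _ at hlow
  have e1 := h.N1_eq
  have e2 := h.N2_eq
  have n3 := N3_nonneg R χ
  have a1 : 0 ≤ ∫ x, du χ x ^ 2 := integral_nonneg fun x => sq_nonneg _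
  have a2 : 0 ≤ ∫ x, dv χ x ^ 2 := integral_nonneg fun x => sq_nonneg _
  have a3 : 0 ≤ ∫ x, om x * uu χ x ^ 2 :=
    integral_nonneg fun x => by have := om_pos x; positivity
  have a4 : 0 ≤ ∫ x, om x * vv χ x ^ 2 :=
    integral_nonneg fun x => by have := om_pos x; positivity
  have b3 : 37 * κ / om R ≤ c1 / 2 := by
    rw [div_le_iff₀ oR]; linarith
  rw [rr, e1, e2]
  rw [e2] at hlow
  exact lower_arith hc1 hc1C hc18 hP0 hκP b3 a1 a2 a3 a4 n3 hWom hQ hL hlow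

end lower
end

section
open Real MeasureTheory Set ENNReal

/-! ### Pointwise bounds, symmetries, comparison with `rho` -/

section sup
variable {R : ℝ} {χ : ℝ → ℂ}

lemma Adm.w_holder (h : Adm R χ) (x y : ℝ) :
    ‖(χ y - (φ y : ℂ)) - (χ x - (φ x : ℂ))‖ ^ 2 ≤ |y - x| * N1 χ := by
  refine holder (f := fun x => χ x - (φ x : ℂ)) (f' := fun x => deriv χ x - (dphi x : ℂ))
    (fun x => ?_) ?_ h.i1 x y
  · exact (h.hasDeriv x).sub (phi_hasDerivAt x).ofReal_comp
  · exact h.contD.sub (Complex.continuous_ofReal.comp dphi_cont)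

lemma Adm.sup_left (h : Adm R χ) {S x : ℝ} (hx : x ≤ S) :
    ‖χ x - (φ x : ℂ)‖ ^ 2 ≤ 2 * N1 χ + 2 / om S * N2 χ := by
  have oS := om_pos S
  have key : ∀ y ∈ Ioc (x - 1) x, om S * (‖χ x - (φ x : ℂ)‖ ^ 2 - 2 * N1 χ) ≤
      2 * (om y * ‖χ y - (φ y : ℂ)‖ ^ 2) := by
    intro y hy
    have h1 := h.w_holder y x
    have h2 : |x - y| ≤ 1 := by rw [abs_le]; constructor <;> linarith [hy.1, hy.2]
    have h3 : |x - y| * N1 χ ≤ N1 χ := by nlinarith [N1_nonneg χ]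
    have h4 : ‖χ x - (φ x : ℂ)‖ ≤ ‖χ y - (φ y : ℂ)‖ +
        ‖(χ x - (φ x : ℂ)) - (χ y - (φ y : ℂ))‖ := by
      have := norm_add_le (χ y - (φ y : ℂ)) ((χ x - (φ x : ℂ)) - (χ y - (φ y : ℂ)))
      rwa [add_sub_cancel] at this
    set a := ‖χ x - (φ x : ℂ)‖
    set b := ‖χ y - (φ y : ℂ)‖
    set d := ‖(χ x - (φ x : ℂ)) - (χ y - (φ y : ℂ))‖
    have a0 : 0 ≤ a := norm_nonneg _
    have h5 : a ^ 2 ≤ 2 * b ^ 2 + 2 * d ^ 2 := by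
      have : a ^ 2 ≤ (b + d) ^ 2 := by gcongr
      nlinarith [sq_nonneg (b - d)]
    have ho : om S ≤ om y := om_anti (hy.2.trans hx)
    have h6 : om S * (a ^ 2 - 2 * N1 χ) ≤ om S * (2 * b ^ 2) := by
      gcongr; linarith
    nlinarith [sq_nonneg b]
  have h1 : ∫ y in Ioc (x - 1) x, om S * (‖χ x - (φ x : ℂ)‖ ^ 2 - 2 * N1 χ) ≤
      ∫ y in Ioc (x - 1) x, 2 * (om y * ‖χ y - (φ y : ℂ)‖ ^ 2) :=
    setIntegral_mono_on continuous_const.integrableOn_Ioc (h.i2.const_mul 2).integrableOn measurableSet_Ioc key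
  have h2 : ∫ y in Ioc (x - 1) x, 2 * (om y * ‖χ y - (φ y : ℂ)‖ ^ 2) ≤ 2 * N2 χ := by
    rw [N2, ← integral_const_mul]
    refine setIntegral_le_integral (h.i2.const_mul 2) (Filter.Eventually.of_forall fun y => ?_)
    have := om_pos y
    simp only [Pi.zero_apply]
    positivity
  have h3 : ∫ y in Ioc (x - 1) x, om S * (‖χ x - (φ x : ℂ)‖ ^ 2 - 2 * N1 χ) =
      om S * (‖χ x - (φ x : ℂ)‖ ^ 2 - 2 * N1 χ) := by simp
  rw [h3] at h1
  have h4 : ‖χ x - (φ x : ℂ)‖ ^ 2 - 2 * N1 χ ≤ 2 * N2 χ / om S := by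
    rw [le_div_iff₀ oS]; linarith
  have h5 : 2 * N2 χ / om S = 2 / om S * N2 χ := by ring
  linarith

lemma sup_left_small (R S : ℝ) {κ : ℝ} (hκ : 0 < κ) : ∃ ρ > 0, ∀ χ : ℝ → ℂ, Adm R χ →
    rr R χ < ρ → ∀ x ≤ S, ‖χ x - (φ x : ℂ)‖ ≤ κ := by
  have oS := om_pos S
  refine ⟨κ ^ 2 / (2 + 2 / om S), by positivity, fun χ h hr x hx => ?_⟩
  have h1 := h.sup_left hx
  rw [lt_div_iff₀ (by positivity)] at hr
  have n1 := N1_nonneg χ; have n2 := N2_nonneg χ; have n3 := N3_nonneg R χ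
  have d : 0 ≤ 2 / om S := by positivity
  rw [rr] at hr
  refine abs_le_of_sq_le_sq' ?_ hκ.le |>.2
  nlinarith [mul_nonneg d n1, mul_nonneg d n2, mul_nonneg d n3]

lemma eta_small (R : ℝ) {κ : ℝ} (hκ : 0 < κ) : ∃ ρ > 0, ∀ χ : ℝ → ℂ, Adm R χ →
    rr R χ < ρ → ∀ x > R, |eta χ x| ≤ κ := by
  obtain ⟨c, hc, hc1, hck⟩ : ∃ c > 0, c ≤ 1 ∧ 3 * c ≤ κ :=
    ⟨min 1 (κ / 3), by positivity, min_le_left _ _, by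
      have := min_le_right 1 (κ / 3); linarith⟩
  have pR := phi_pos R
  obtain ⟨l, hl⟩ : ∃ l, l = (c / 6) ^ 2 := ⟨_, rfl⟩
  have l0 : 0 < l := by rw [hl]; positivity
  have lc : l ≤ c / 36 := by rw [hl]; nlinarith
  refine ⟨min 1 (l * (c / 2 * φ R) ^ 2), by positivity, fun χ h hr x hx => ?_⟩
  have n1 := N1_nonneg χ; have n2 := N2_nonneg χ; have n3 := N3_nonneg R χ
  have hr1 : N1 χ ≤ 1 := by
    have := hr.trans_le (min_le_left _ _); rw [rr] at this; linarith
  have hr2 : N3 R χ < l * (c / 2 * φ R) ^ 2 := by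
    have := hr.trans_le (min_le_right _ _); rw [rr] at this; linarith
  have hq : |‖χ x‖ - φ x| ≤ c := by
    by_contra hcon
    push Not at hcon
    refine absurd hr2 (not_lt.2 ?_)
    have key : ∀ y ∈ Ioc x (x + l), (c / 2 * φ R) ^ 2 ≤ (‖χ y‖ ^ 2 - φ y ^ 2) ^ 2 := by
      intro y hy
      have h1 := h.w_holder x y
      have hyx : |y - x| ≤ l := by rw [abs_le]; constructor <;> linarith [hy.1, hy.2]
      have h2 : ‖(χ y - (φ y : ℂ)) - (χ x - (φ x : ℂ))‖ ≤ c / 6 := by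
        refine abs_le_of_sq_le_sq' ?_ (by positivity) |>.2
        rw [← hl]
        nlinarith [abs_nonneg (y - x)]
      have h3 := (phi_lip y x).trans hyx
      have h4 : ‖χ y - χ x‖ ≤ c / 6 + l := by
        have e : χ y - χ x = ((χ y - (φ y : ℂ)) - (χ x - (φ x : ℂ))) + ((φ y - φ x : ℝ) : ℂ) := by
          push_cast; ring
        rw [e]
        refine (norm_add_le _ _).trans ?_
        rw [Complex.norm_real, Real.norm_eq_abs]
        linarith
      have h5 := (abs_norm_sub_norm_le (χ y) (χ x)).trans h4
      have h6 : c / 2 ≤ |‖χ y‖ - φ y| := by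
        have e : ‖χ x‖ - φ x = (‖χ y‖ - φ y) - ((‖χ y‖ - ‖χ x‖) - (φ y - φ x)) := by ring
        rw [e] at hcon
        have h7 := abs_sub (‖χ y‖ - φ y) ((‖χ y‖ - ‖χ x‖) - (φ y - φ x))
        have h8 := abs_sub (‖χ y‖ - ‖χ x‖) (φ y - φ x)
        linarith
      have hpy : φ R ≤ ‖χ y‖ + φ y := by
        have := phi_mono.monotone (show R ≤ y by linarith [hy.1])
        linarith [norm_nonneg (χ y)]
      have e2 : ‖χ y‖ ^ 2 - φ y ^ 2 = (‖χ y‖ - φ y) * (‖χ y‖ + φ y) := by ring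
      rw [e2, mul_pow, mul_pow]
      have h9 : (c / 2) ^ 2 ≤ (‖χ y‖ - φ y) ^ 2 := by
        rw [← sq_abs (‖χ y‖ - φ y)]; gcongr
      gcongr
    have hsub : Ioc x (x + l) ⊆ Ioi R := fun y hy => lt_trans hx hy.1
    have h1 : ∫ y in Ioc x (x + l), (c / 2 * φ R) ^ 2 ≤
        ∫ y in Ioc x (x + l), (‖χ y‖ ^ 2 - φ y ^ 2) ^ 2 :=
      setIntegral_mono_on continuous_const.integrableOn_Ioc (h.i3.mono_set hsub) measurableSet_Ioc key
    have h2 : ∫ y in Ioc x (x + l), (‖χ y‖ ^ 2 - φ y ^ 2) ^ 2 ≤ N3 R χ :=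
      setIntegral_mono_set h.i3 (Filter.Eventually.of_forall fun y => by positivity)
        (Filter.Eventually.of_forall hsub)
    have h3 : ∫ y in Ioc x (x + l), (c / 2 * φ R) ^ 2 = l * (c / 2 * φ R) ^ 2 := by
      simp [l0.le]
    linarith
  have e2 : eta χ x = (‖χ x‖ - φ x) * ((‖χ x‖ - φ x) + 2 * φ x) := by rw [eta]; ring
  rw [e2, abs_mul]
  have p0 := phi_pos x; have p1 := phi_lt_one x
  have h3 : |(‖χ x‖ - φ x) + 2 * φ x| ≤ 3 := by
    rw [abs_le] at hq ⊢
    constructor <;> linarith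
  calc _ ≤ c * 3 := by gcongr
    _ ≤ κ := by linarith

end sup

/-! ### Symmetries -/

lemma deriv_shift (χ : ℝ → ℂ) (θ : ℂ) (b x : ℝ) :
    deriv (fun x => θ * χ (x + b)) x = θ * deriv χ (x + b) := by
  rw [deriv_const_mul_field, deriv_comp_add_const]

lemma energy_shift (χ : ℝ → ℂ) {θ : ℂ} (hθ : ‖θ‖ = 1) (b : ℝ) :
    energy (fun x => θ * χ (x + b)) = energy χ := by
  unfold energy
  simp only [deriv_shift, norm_mul, hθ, one_mul]
  exact lintegral_add_right_eq_self
    (fun x => ENNReal.ofReal (‖deriv χ x‖ ^ 2 + ‖χ x‖ ^ 2 * (1 - ‖χ x‖ ^ 2) ^ 2)) b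

lemma om_sq_int (S : ℝ) : IntegrableOn (fun x => om x ^ 2) (Ioi S) := by
  have pS := phi_pos S
  refine Integrable.mono' (phi_dphi_int.const_mul (1 / φ S ^ 2)).integrableOn
    (om_cont.pow 2).aestronglyMeasurable ?_
  refine (ae_restrict_iff' measurableSet_Ioi).2 (Filter.Eventually.of_forall fun x hx => ?_)
  have o1 := om_pos x; have o2 := om_lt_one x
  have hp : φ S ^ 2 ≤ φ x ^ 2 := by
    have := phi_mono.monotone (le_of_lt (mem_Ioi.1 hx)); gcongr
  rw [Real.norm_eq_abs, abs_of_nonneg (sq_nonneg _), one_div_mul_eq_div,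
    le_div_iff₀ (by positivity)]
  have : om x ^ 2 ≤ om x := by nlinarith
  nlinarith [mul_nonneg o1.le (sq_nonneg (φ S))]

lemma sq_add3 {a b c d : ℝ} (ha : 0 ≤ a) (h : a ≤ b + c + d) :
    a ^ 2 ≤ 3 * (b ^ 2 + c ^ 2 + d ^ 2) := by
  have : a ^ 2 ≤ (b + c + d) ^ 2 := by gcongr
  nlinarith [sq_nonneg (b - c), sq_nonneg (b - d), sq_nonneg (c - d)]

lemma Adm.shift {R : ℝ} {χ : ℝ → ℂ} (h : Adm R χ) {θ : ℂ} (hθ : ‖θ‖ = 1) (b : ℝ) :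
    Adm R (fun x => θ * χ (x + b)) := by
  have pc := phi_cont; have oc := om_cont; have dc := dphi_cont; have cc := h.cont
  have cd := h.contD; have ec := h.eta_cont
  have hs : ContDiff ℝ 1 (fun x => θ * χ (x + b)) := by
    have := h.smooth
    exact contDiff_const.mul (this.comp (contDiff_id.add contDiff_const))
  have key : ∀ z d d' : ℂ, ‖θ * z - d‖ ^ 2 ≤ 3 * (‖z - d'‖ ^ 2 + ‖d'‖ ^ 2 + ‖d‖ ^ 2) := by
    intro z d d'
    refine sq_add3 (norm_nonneg _) ?_
    have e : θ * z - d = θ * (z - d') + θ * d' - d := by ring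
    rw [e]
    refine (norm_sub_le _ _).trans ?_
    gcongr
    refine (norm_add_le _ _).trans ?_
    rw [norm_mul, norm_mul, hθ, one_mul, one_mul]
  refine ⟨hs, ?_, ?_, ?_⟩
  · simp only [deriv_shift]
    refine Integrable.mono' ((((h.i1.comp_add_right b).add (dphi_sq_int.comp_add_right b)).add
      dphi_sq_int).const_mul 3) (by fun_prop) (Filter.Eventually.of_forall fun x => ?_)
    rw [Real.norm_eq_abs, abs_of_nonneg (by positivity)]
    have := key (deriv χ (x + b)) (dphi x) (dphi (x + b))
    simpa [Complex.norm_real] using this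
  · refine Integrable.mono' ((((h.i2.comp_add_right b).const_mul (3 * Real.exp (2 * |b|))).add
      ((phi_dphi_int.comp_add_right b).const_mul (3 * Real.exp (2 * |b|)))).add
      (phi_dphi_int.const_mul 3)) (by fun_prop) (Filter.Eventually.of_forall fun x => ?_)
    have o1 := om_pos x
    rw [Real.norm_eq_abs, abs_of_nonneg (by positivity)]
    have h1 := key (χ (x + b)) (φ x) (φ (x + b))
    have h2 := om_le_shift x b
    simp only [Complex.norm_real, Real.norm_eq_abs, sq_abs] at h1
    simp only [Pi.add_apply]
    have h3 := mul_le_mul_of_nonneg_left h1 o1.le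
    have h4 := mul_le_mul_of_nonneg_right h2
      (by positivity : 0 ≤ ‖χ (x + b) - (φ (x + b) : ℂ)‖ ^ 2 + φ (x + b) ^ 2)
    nlinarith
  · simp only [norm_mul, hθ, one_mul]
    have hS : ∀ f : ℝ → ℝ, IntegrableOn f (Ioi (R + b)) →
        IntegrableOn (fun x => f (x + b)) (Ioi R) := by
      intro f hf
      have := (measurePreserving_add_right volume b).integrableOn_comp_preimage
        (measurableEmbedding_addRight b) (f := f) (s := Ioi (R + b))
      have h2 := this.2 hf
      simpa [Function.comp_def] using h2
    have hE : IntegrableOn (fun x => eta χ x ^ 2) (Ioi (R + b)) := by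
      have h1 : IntegrableOn (fun x => eta χ x ^ 2) (Icc (R + b) R ∪ Ioi R) :=
        ((ec.pow 2).integrableOn_Icc).union h.i3
      refine h1.mono_set fun x hx => ?_
      rcases le_or_gt x R with h2 | h2
      · exact Or.inl ⟨le_of_lt hx, h2⟩
      · exact Or.inr h2
    refine Integrable.mono' (((hS _ hE).add (hS _ (om_sq_int (R + b)))).add
      (om_sq_int R) |>.const_mul 3) (Continuous.aestronglyMeasurable (by fun_prop))
      (Filter.Eventually.of_forall fun x => ?_)
    rw [Real.norm_eq_abs, abs_of_nonneg (by positivity)]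
    simp only [Pi.add_apply]
    have e : ‖χ (x + b)‖ ^ 2 - φ x ^ 2 = eta χ (x + b) - om (x + b) + om x := by
      simp only [eta, om]; ring
    rw [e]
    nlinarith [sq_nonneg (eta χ (x + b) + om (x + b)), sq_nonneg (eta χ (x + b) - om x),
      sq_nonneg (om (x + b) + om x)]

/-! ### Comparison with `rho` -/

lemma nnnorm_sq_eq (z : ℂ) : (‖z‖₊ : ℝ≥0∞) ^ 2 = ENNReal.ofReal (‖z‖ ^ 2) := by
  rw [ENNReal.ofReal_pow (norm_nonneg _), ofReal_norm]; rfl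

lemma Adm.iW {R : ℝ} {χ : ℝ → ℂ} (h : Adm R χ) :
    Integrable (fun x => W R x * ‖χ x - (φ x : ℂ)‖ ^ 2) := by
  have pc := phi_cont; have cc := h.cont
  refine (h.i2.const_mul (1 / om R)).mono'
    ((W_meas R).aestronglyMeasurable.mul (Continuous.aestronglyMeasurable (by fun_prop)))
    (Filter.Eventually.of_forall fun x => ?_)
  have := W_pos R x
  rw [Real.norm_eq_abs, abs_of_nonneg (by positivity)]
  calc W R x * ‖χ x - (φ x : ℂ)‖ ^ 2 ≤ (om x / om R) * ‖χ x - (φ x : ℂ)‖ ^ 2 := by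
        gcongr; exact W_le R x
    _ = 1 / om R * (om x * ‖χ x - (φ x : ℂ)‖ ^ 2) := by ring

lemma Adm.rho_eq {R : ℝ} {χ : ℝ → ℂ} (h : Adm R χ) :
    rho R χ = ENNReal.ofReal (N1 χ + (∫ x, W R x * ‖χ x - (φ x : ℂ)‖ ^ 2) + N3 R χ) := by
  have hW0 : 0 ≤ ∫ x, W R x * ‖χ x - (φ x : ℂ)‖ ^ 2 :=
    integral_nonneg fun x => by have := W_pos R x; positivity
  rw [ENNReal.ofReal_add (add_nonneg (N1_nonneg χ) hW0) (N3_nonneg R χ),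
    ENNReal.ofReal_add (N1_nonneg χ) hW0, rho]
  have hd : deriv φ = dphi := funext phi_deriv
  simp only [nnnorm_sq_eq, hd]
  congr 1
  · congr 1
    · rw [N1, ofReal_integral_eq_lintegral_ofReal h.i1
        (Filter.Eventually.of_forall fun x => by positivity)]
    · rw [ofReal_integral_eq_lintegral_ofReal h.iW
        (Filter.Eventually.of_forall fun x => by have := W_pos R x; positivity)]
      refine lintegral_congr fun x => ?_
      rw [ENNReal.ofReal_mul (W_pos R x).le]
  · rw [N3, ofReal_integral_eq_lintegral_ofReal h.i3
        (Filter.Eventually.of_forall fun x => by positivity)]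

lemma Adm.rr_le {R : ℝ} {χ : ℝ → ℂ} (h : Adm R χ) : ENNReal.ofReal (rr R χ) ≤ rho R χ := by
  rw [h.rho_eq, rr]
  refine ENNReal.ofReal_le_ofReal ?_
  have : N2 χ ≤ ∫ x, W R x * ‖χ x - (φ x : ℂ)‖ ^ 2 := by
    refine integral_mono h.i2 h.iW fun x => ?_
    simp only
    gcongr
    exact om_le_W R x
  linarith

lemma Adm.le_rr {R : ℝ} {χ : ℝ → ℂ} (h : Adm R χ) :
    rho R χ ≤ ENNReal.ofReal (rr R χ / om R) := by
  have oR := om_pos R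
  rw [h.rho_eq, rr]
  refine ENNReal.ofReal_le_ofReal ?_
  have h1 : ∫ x, W R x * ‖χ x - (φ x : ℂ)‖ ^ 2 ≤ 1 / om R * N2 χ := by
    rw [N2, ← integral_const_mul]
    refine integral_mono h.iW (h.i2.const_mul _) fun x => ?_
    simp only
    calc W R x * ‖χ x - (φ x : ℂ)‖ ^ 2 ≤ (om x / om R) * ‖χ x - (φ x : ℂ)‖ ^ 2 := by
          gcongr; exact W_le R x
      _ = 1 / om R * (om x * ‖χ x - (φ x : ℂ)‖ ^ 2) := by ring
  have h2 : 1 ≤ 1 / om R := by rw [le_div_iff₀ oR]; linarith [om_lt_one R]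
  have e : (N1 χ + N2 χ + N3 R χ) / om R = 1 / om R * N1 χ + 1 / om R * N2 χ + 1 / om R * N3 R χ := by
    ring
  rw [e]
  nlinarith [N1_nonneg χ, N3_nonneg R χ]
end

section
open Real MeasureTheory Set ENNReal

/-! ### Modulation -/

lemma G_int (b : ℝ) : Integrable (fun x => (φ (x + b) - φ x) * dphi x) := by
  have pc := phi_cont; have dc := dphi_cont
  refine dphi_int.mono' (Continuous.aestronglyMeasurable (by fun_prop))
    (Filter.Eventually.of_forall fun x => ?_)
  have d := dphi_pos x
  rw [norm_mul, Real.norm_eq_abs, Real.norm_eq_abs, abs_of_pos d]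
  have : |φ (x + b) - φ x| ≤ 1 := by
    have := phi_pos x; have := phi_lt_one x
    have := phi_pos (x + b); have := phi_lt_one (x + b)
    rw [abs_le]; constructor <;> linarith
  nlinarith

lemma G_pos {b : ℝ} (hb : 0 < b) : 0 < ∫ x, (φ (x + b) - φ x) * dphi x := by
  have hp : ∀ x, 0 < (φ (x + b) - φ x) * dphi x := fun x =>
    mul_pos (sub_pos.2 (phi_mono (by linarith))) (dphi_pos x)
  rw [integral_pos_iff_support_of_nonneg (fun x => (hp x).le) (G_int b)]
  have : Function.support (fun x => (φ (x + b) - φ x) * dphi x) = univ := by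
    ext x; simp only [Function.mem_support, mem_univ, iff_true]; exact (hp x).ne'
  rw [this]; simp

lemma G_neg {b : ℝ} (hb : 0 < b) : ∫ x, (φ (x + -b) - φ x) * dphi x < 0 := by
  have hp : ∀ x, 0 < -((φ (x + -b) - φ x) * dphi x) := fun x => by
    have h1 : φ (x + -b) < φ x := phi_mono (by linarith)
    have h2 := dphi_pos x
    nlinarith
  have : 0 < ∫ x, -((φ (x + -b) - φ x) * dphi x) := by
    rw [integral_pos_iff_support_of_nonneg (fun x => (hp x).le) (G_int (-b)).neg]
    have : Function.support (fun x => -((φ (x + -b) - φ x) * dphi x)) = univ := by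
      ext x; simp only [Function.mem_support, mem_univ, iff_true]; exact (hp x).ne'
    rw [this]; simp
  rw [integral_neg] at this
  linarith

section modul
variable {R : ℝ} {χ : ℝ → ℂ}

/-- Pointwise bound of the translated perturbation against the derivative of the kink. -/
lemma Adm.w_shift_bound (h : Adm R χ) {k b : ℝ} (hk : 0 < k) (hb : |b| ≤ 1) (h1 : N1 χ ≤ k ^ 2)
    (x : ℝ) : ‖χ (x + b) - (φ (x + b) : ℂ)‖ * dphi x ≤
      (1 / (2 * k)) * (om x * ‖χ x - (φ x : ℂ)‖ ^ 2) + (k / 2) * (φ x ^ 2 * om x) + k * dphi x := by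
  have hh := h.w_holder x (x + b)
  rw [add_sub_cancel_left] at hh
  have h2 : ‖(χ (x + b) - (φ (x + b) : ℂ)) - (χ x - (φ x : ℂ))‖ ≤ k := by
    refine abs_le_of_sq_le_sq' ?_ hk.le |>.2
    nlinarith [abs_nonneg b, N1_nonneg χ]
  have h3 : ‖χ (x + b) - (φ (x + b) : ℂ)‖ ≤ ‖χ x - (φ x : ℂ)‖ + k := by
    have := norm_add_le (χ x - (φ x : ℂ)) ((χ (x + b) - (φ (x + b) : ℂ)) - (χ x - (φ x : ℂ)))
    rw [add_sub_cancel] at this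
    linarith
  have d := dphi_pos x
  have o := om_pos x
  have h4 : ‖χ x - (φ x : ℂ)‖ * dphi x ≤
      (1 / (2 * k)) * (om x * ‖χ x - (φ x : ℂ)‖ ^ 2) + (k / 2) * (φ x ^ 2 * om x) := by
    set n := ‖χ x - (φ x : ℂ)‖
    have e : (1 / (2 * k)) * (om x * n ^ 2) + (k / 2) * (φ x ^ 2 * om x) - n * dphi x =
        om x / (2 * k) * (n - k * φ x) ^ 2 := by
      unfold dphi; field_simp; ring
    have : 0 ≤ om x / (2 * k) * (n - k * φ x) ^ 2 := by positivity
    linarith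
  nlinarith

lemma Adm.bound_int (h : Adm R χ) (a b c : ℝ) :
    Integrable (fun x => a * (om x * ‖χ x - (φ x : ℂ)‖ ^ 2) + b * (φ x ^ 2 * om x) + c * dphi x) :=
  ((h.i2.const_mul a).add (phi_dphi_int.const_mul b)).add (dphi_int.const_mul c)

lemma Adm.mod_est (h : Adm R χ) {θ : ℂ} (hθ : ‖θ‖ = 1) {k b τ : ℝ} (hk : 0 < k) (hb : |b| ≤ 1)
    (h1 : N1 χ ≤ k ^ 2) (h2 : N2 χ ≤ k ^ 2) (hτ : ‖θ - 1‖ ≤ τ) :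
    |(∫ x, uu (fun x => θ * χ (x + b)) x * dphi x) - ∫ x, (φ (x + b) - φ x) * dphi x| ≤
      k * (1 + ∫ x, φ x ^ 2 * om x) + (k + τ) * ∫ x, dphi x := by
  have i1 : Integrable (fun x => uu (fun x => θ * χ (x + b)) x * dphi x) := by
    have := (h.shift hθ b).dphi_uu_int
    simpa only [mul_comm] using this
  rw [← integral_sub i1 (G_int b), ← Real.norm_eq_abs]
  have hτ0 : 0 ≤ τ := (norm_nonneg _).trans hτ
  refine (norm_integral_le_of_norm_le (h.bound_int (1 / (2 * k)) (k / 2) (k + τ))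
    (Filter.Eventually.of_forall fun x => ?_)).trans ?_
  · have d := dphi_pos x
    have e : uu (fun x => θ * χ (x + b)) x * dphi x - (φ (x + b) - φ x) * dphi x =
        (θ * (χ (x + b) - (φ (x + b) : ℂ)) + (θ - 1) * (φ (x + b) : ℂ)).re * dphi x := by
      have : θ * (χ (x + b) - (φ (x + b) : ℂ)) + (θ - 1) * (φ (x + b) : ℂ) =
        θ * χ (x + b) - (φ (x + b) : ℂ) := by ring
      rw [this]
      simp only [uu, Complex.sub_re, Complex.ofReal_re]
      ring
    rw [e, norm_mul, Real.norm_eq_abs, Real.norm_eq_abs, abs_of_pos d]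
    have h3 := Complex.abs_re_le_norm
      (θ * (χ (x + b) - (φ (x + b) : ℂ)) + (θ - 1) * (φ (x + b) : ℂ))
    have h4 := norm_add_le (θ * (χ (x + b) - (φ (x + b) : ℂ))) ((θ - 1) * (φ (x + b) : ℂ))
    rw [norm_mul, norm_mul, hθ, one_mul, Complex.norm_real, Real.norm_eq_abs,
      abs_of_pos (phi_pos _)] at h4
    have h5 : ‖θ - 1‖ * φ (x + b) ≤ τ := by
      nlinarith [norm_nonneg (θ - 1), phi_pos (x + b), phi_lt_one (x + b)]
    have h6 := h.w_shift_bound hk hb h1 x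
    have h7 := mul_le_mul_of_nonneg_right (h3.trans h4) d.le
    nlinarith
  · have i12 : Integrable (fun x => (1 / (2 * k)) * (om x * ‖χ x - (φ x : ℂ)‖ ^ 2) +
        (k / 2) * (φ x ^ 2 * om x)) :=
      (h.i2.const_mul _).add (phi_dphi_int.const_mul _)
    rw [integral_add i12 (dphi_int.const_mul _), integral_const_mul (k + τ) dphi]
    have e1 : ∫ x, ((1 / (2 * k)) * (om x * ‖χ x - (φ x : ℂ)‖ ^ 2) + (k / 2) * (φ x ^ 2 * om x)) =
        1 / (2 * k) * N2 χ + k / 2 * ∫ x, φ x ^ 2 * om x := by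
      rw [integral_add (h.i2.const_mul _) (phi_dphi_int.const_mul _), integral_const_mul,
        integral_const_mul, N2]
    have e2 : 1 / (2 * k) * N2 χ ≤ k := by
      rw [one_div_mul_eq_div, div_le_iff₀ (by positivity)]
      nlinarith
    have e3 : 0 ≤ ∫ x, φ x ^ 2 * om x :=
      integral_nonneg fun x => by have := om_pos x; positivity
    rw [e1]
    nlinarith

/-- The phase that makes `θ χ(b)` a nonnegative real. -/
noncomputable def ph (χ : ℝ → ℂ) (b : ℝ) : ℂ := (starRingEnd ℂ) (χ b) / (‖χ b‖ : ℂ)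

lemma ph_norm {b : ℝ} (h : χ b ≠ 0) : ‖ph χ b‖ = 1 := by
  have : ‖χ b‖ ≠ 0 := norm_ne_zero_iff.2 h
  rw [ph, norm_div, RCLike.norm_conj, Complex.norm_real, norm_norm, div_self this]

lemma ph_mul (b : ℝ) : (ph χ b * χ b).im = 0 := by
  have : ph χ b * χ b = ((‖χ b‖ ^ 2 / ‖χ b‖ : ℝ) : ℂ) := by
    rw [ph, div_mul_eq_mul_div, Complex.conj_mul']
    push_cast; rfl
  rw [this, Complex.ofReal_im]

lemma ph_sub_one {b r : ℝ} (h : χ b ≠ 0) : ‖ph χ b - 1‖ * ‖χ b‖ ≤ 2 * ‖χ b - ((r : ℝ) : ℂ)‖ ∨ r < 0 := by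
  by_cases hr : r < 0
  · exact Or.inr hr
  left
  push Not at hr
  have h0 : ‖χ b‖ ≠ 0 := norm_ne_zero_iff.2 h
  have h0' : (‖χ b‖ : ℂ) ≠ 0 := by exact_mod_cast h0
  have e : (ph χ b - 1) * (‖χ b‖ : ℂ) = (starRingEnd ℂ) (χ b - (‖χ b‖ : ℂ)) := by
    rw [ph, sub_mul, div_mul_cancel₀ _ h0', map_sub, Complex.conj_ofReal, one_mul]
  have e2 : ‖ph χ b - 1‖ * ‖χ b‖ = ‖χ b - (‖χ b‖ : ℂ)‖ := by
    have := congrArg norm e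
    rwa [norm_mul, RCLike.norm_conj, Complex.norm_real, norm_norm] at this
  rw [e2]
  have e3 : χ b - (‖χ b‖ : ℂ) = (χ b - (r : ℂ)) + ((r - ‖χ b‖ : ℝ) : ℂ) := by push_cast; ring
  rw [e3]
  refine (norm_add_le _ _).trans ?_
  rw [Complex.norm_real, Real.norm_eq_abs]
  have h4 : |r - ‖χ b‖| ≤ ‖χ b - (r : ℂ)‖ := by
    have := abs_norm_sub_norm_le (r : ℂ) (χ b)
    rw [Complex.norm_real, Real.norm_eq_abs, abs_of_nonneg hr, norm_sub_rev] at this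
    exact this
  linarith

lemma modulation {R : ℝ} (hR : 0 < R) {κ : ℝ} (hκ : 0 < κ) : ∃ ρ > 0, ∀ χ : ℝ → ℂ, Adm R χ →
    rr R χ < ρ → ∃ (θ : ℂ) (b : ℝ), ‖θ‖ = 1 ∧ (θ * χ (0 + b)).im = 0 ∧
      (∫ x, uu (fun x => θ * χ (x + b)) x * dphi x) = 0 ∧
      (∀ x ≤ R, ‖θ * χ (x + b) - (φ x : ℂ)‖ ≤ κ) ∧
      ∀ x > R, |eta (fun x => θ * χ (x + b)) x| ≤ κ := by
  obtain ⟨b, hb, hb1, hbκ⟩ : ∃ b > 0, b ≤ 1 ∧ b ≤ κ / 4 :=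
    ⟨min 1 (κ / 4), by positivity, min_le_left _ _, min_le_right _ _⟩
  set p0 := φ (-1) with hp0
  have p0pos : 0 < p0 := phi_pos _
  obtain ⟨μ, hμ, hμ1, hμ2⟩ : ∃ μ > 0, μ ≤ (∫ x, (φ (x + b) - φ x) * dphi x) ∧
      (∫ x, (φ (x + -b) - φ x) * dphi x) ≤ -μ := by
    have h1 := G_pos hb; have h2 := G_neg hb
    refine ⟨min (∫ x, (φ (x + b) - φ x) * dphi x) (-∫ x, (φ (x + -b) - φ x) * dphi x),
      lt_min h1 (by linarith), min_le_left _ _, ?_⟩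
    have := min_le_right (∫ x, (φ (x + b) - φ x) * dphi x) (-∫ x, (φ (x + -b) - φ x) * dphi x)
    linarith
  obtain ⟨J, hJ⟩ : ∃ J, J = ∫ x, φ x ^ 2 * om x := ⟨_, rfl⟩
  obtain ⟨I, hI⟩ : ∃ I, I = ∫ x, dphi x := ⟨_, rfl⟩
  have J0 : 0 ≤ J := by
    rw [hJ]; exact integral_nonneg fun x => by have := om_pos x; positivity
  have I0 : 0 ≤ I := by rw [hI]; exact integral_nonneg fun x => (dphi_pos x).le
  obtain ⟨M, hM⟩ : ∃ M, M = 1 + J + (1 + 4 / p0) * I := ⟨_, rfl⟩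
  have M0 : 0 < M := by rw [hM]; positivity
  obtain ⟨k, hk, hk1, hkp, hkκ, hkκ', hkM⟩ : ∃ k > 0, k ≤ 1 ∧ k ≤ p0 / 2 ∧
      k * (1 + 4 / p0) ≤ κ / 2 ∧ 3 * k ≤ κ / 2 ∧ k * M ≤ μ := by
    refine ⟨min (min (min 1 (p0 / 2)) (κ / 2 / (1 + 4 / p0))) (min (κ / 6) (μ / M)),
      by positivity, ?_, ?_, ?_, ?_, ?_⟩
    · exact (min_le_left _ _).trans ((min_le_left _ _).trans (min_le_left _ _))
    · exact (min_le_left _ _).trans ((min_le_left _ _).trans (min_le_right _ _))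
    · rw [← le_div_iff₀ (by positivity)]
      exact (min_le_left _ _).trans (min_le_right _ _)
    · have : min (min (min 1 (p0 / 2)) (κ / 2 / (1 + 4 / p0))) (min (κ / 6) (μ / M)) ≤ κ / 6 :=
        (min_le_right _ _).trans (min_le_left _ _)
      linarith
    · rw [← le_div_iff₀ M0]
      exact (min_le_right _ _).trans (min_le_right _ _)
  obtain ⟨ρ1, hρ1, H1⟩ := sup_left_small R (R + 1) hk
  obtain ⟨ρ2, hρ2, H2⟩ := eta_small R hk
  refine ⟨min (k ^ 2) (min ρ1 ρ2), by positivity, fun χ h hr => ?_⟩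
  have hrk := hr.trans_le (min_le_left _ _)
  have hw := H1 χ h (hr.trans_le ((min_le_right _ _).trans (min_le_left _ _)))
  have he := H2 χ h (hr.trans_le ((min_le_right _ _).trans (min_le_right _ _)))
  have n1 := N1_nonneg χ; have n2 := N2_nonneg χ; have n3 := N3_nonneg R χ
  rw [rr] at hrk
  have hN1 : N1 χ ≤ k ^ 2 := by linarith
  have hN2 : N2 χ ≤ k ^ 2 := by linarith
  have habs : ∀ β ∈ Icc (-b) b, |β| ≤ 1 := fun β hβ => by
    rw [abs_le]; constructor <;> linarith [hβ.1, hβ.2]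
  have habsb : ∀ β ∈ Icc (-b) b, |β| ≤ b := fun β hβ => abs_le.2 hβ
  have hχ : ∀ β ∈ Icc (-b) b, p0 / 2 ≤ ‖χ β‖ := by
    intro β hβ
    have h1 := hw β (by linarith [hβ.2])
    have h2 : p0 ≤ φ β := phi_mono.monotone (by linarith [hβ.1])
    have h3 := norm_sub_norm_le (φ β : ℂ) (χ β)
    rw [norm_sub_rev, Complex.norm_real, Real.norm_eq_abs, abs_of_pos (phi_pos β)] at h3
    linarith
  have hχ0 : ∀ β ∈ Icc (-b) b, χ β ≠ 0 := fun β hβ => by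
    rw [← norm_pos_iff]; linarith [hχ β hβ]
  have hθ : ∀ β ∈ Icc (-b) b, ‖ph χ β‖ = 1 := fun β hβ => ph_norm (hχ0 β hβ)
  have hθ1 : ∀ β ∈ Icc (-b) b, ‖ph χ β - 1‖ ≤ 4 * k / p0 := by
    intro β hβ
    rcases ph_sub_one (r := φ β) (hχ0 β hβ) with h1 | h1
    · have h2 := hw β (by linarith [hβ.2])
      rw [le_div_iff₀ p0pos]
      nlinarith [hχ β hβ, norm_nonneg (ph χ β - 1)]
    · linarith [phi_pos β]
  have hest : ∀ β ∈ Icc (-b) b, |(∫ x, uu (fun x => ph χ β * χ (x + β)) x * dphi x) -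
      ∫ x, (φ (x + β) - φ x) * dphi x| ≤ μ := by
    intro β hβ
    have := h.mod_est (hθ β hβ) hk (habs β hβ) hN1 hN2 (hθ1 β hβ)
    rw [← hJ, ← hI] at this
    refine this.trans (le_trans (le_of_eq ?_) hkM)
    rw [hM]; ring
  have hcont : ContinuousOn (fun β => ∫ x, uu (fun x => ph χ β * χ (x + β)) x * dphi x)
      (Icc (-b) b) := by
    have cc := h.cont
    have phc : ContinuousOn (ph χ) (Icc (-b) b) := by
      unfold ph
      refine ContinuousOn.div ?_ ?_ ?_
      · exact (Complex.continuous_conj.comp cc).continuousOn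
      · exact (Complex.continuous_ofReal.comp cc.norm).continuousOn
      · intro β hβ
        exact_mod_cast (norm_ne_zero_iff.2 (hχ0 β hβ))
    refine continuousOn_of_dominated (bound := fun x => (1 / (2 * k)) *
      (om x * ‖χ x - (φ x : ℂ)‖ ^ 2) + (k / 2) * (φ x ^ 2 * om x) + (k + 2) * dphi x)
      (fun β hβ => ?_) (fun β hβ => Filter.Eventually.of_forall fun x => ?_)
      (h.bound_int _ _ _) (Filter.Eventually.of_forall fun x => ?_)
    · exact ((h.shift (hθ β hβ) β).uu_cont.mul dphi_cont).aestronglyMeasurable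
    · have d := dphi_pos x
      rw [norm_mul, Real.norm_eq_abs, Real.norm_eq_abs, abs_of_pos d]
      have h6 := h.w_shift_bound hk (habs β hβ) hN1 x
      have h7 : |uu (fun x => ph χ β * χ (x + β)) x| ≤ ‖χ (x + β) - (φ (x + β) : ℂ)‖ + 2 := by
        have e : uu (fun x => ph χ β * χ (x + β)) x =
            (ph χ β * (χ (x + β) - (φ (x + β) : ℂ)) + (ph χ β * (φ (x + β) : ℂ) - (φ x : ℂ))).re := by
          have : ph χ β * (χ (x + β) - (φ (x + β) : ℂ)) + (ph χ β * (φ (x + β) : ℂ) - (φ x : ℂ)) =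
            ph χ β * χ (x + β) - (φ x : ℂ) := by ring
          rw [this]
          simp only [uu, Complex.sub_re, Complex.ofReal_re]
        rw [e]
        refine (Complex.abs_re_le_norm _).trans ((norm_add_le _ _).trans ?_)
        rw [norm_mul, hθ β hβ, one_mul]
        gcongr
        refine (norm_sub_le _ _).trans ?_
        rw [norm_mul, hθ β hβ, one_mul, Complex.norm_real, Complex.norm_real, Real.norm_eq_abs,
          Real.norm_eq_abs, abs_of_pos (phi_pos _), abs_of_pos (phi_pos _)]
        linarith [phi_lt_one x, phi_lt_one (x + β)]
      nlinarith
    · have : ContinuousOn (fun β => (ph χ β * χ (x + β))) (Icc (-b) b) :=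
        phc.mul (cc.comp (continuous_const.add continuous_id)).continuousOn
      exact ((Complex.continuous_re.comp_continuousOn this).sub continuousOn_const).mul
        continuousOn_const
  have hIVT := intermediate_value_Icc (by linarith : -b ≤ b) hcont
  have hmem : (0 : ℝ) ∈ Icc (∫ x, uu (fun x => ph χ (-b) * χ (x + -b)) x * dphi x)
      (∫ x, uu (fun x => ph χ b * χ (x + b)) x * dphi x) := by
    have h1 := (abs_le.1 (hest b ⟨by linarith, le_rfl⟩)).1
    have h2 := (abs_le.1 (hest (-b) ⟨le_rfl, by linarith⟩)).2
    constructor <;> linarith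
  obtain ⟨β, hβ, hβ0⟩ := hIVT hmem
  have hlip : ∀ x, |φ (x + β) - φ x| ≤ b := fun x => by
    refine (phi_lip _ _).trans ?_
    rw [add_sub_cancel_left]; exact habsb β hβ
  refine ⟨ph χ β, β, hθ β hβ, ?_, hβ0, fun x hx => ?_, fun x hx => ?_⟩
  · rw [zero_add]; exact ph_mul β
  · have e : ph χ β * χ (x + β) - (φ x : ℂ) = ph χ β * (χ (x + β) - (φ (x + β) : ℂ)) +
        (ph χ β - 1) * (φ (x + β) : ℂ) + ((φ (x + β) - φ x : ℝ) : ℂ) := by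
      push_cast; ring
    rw [e]
    refine (norm_add_le _ _).trans ((add_le_add_left (norm_add_le _ _) _).trans ?_)
    rw [norm_mul, norm_mul, hθ β hβ, one_mul, Complex.norm_real, Complex.norm_real,
      Real.norm_eq_abs, Real.norm_eq_abs, abs_of_pos (phi_pos _)]
    have h1 := hw (x + β) (by linarith [hβ.2])
    have h2 := hθ1 β hβ
    have h3 := hlip x
    have h4 : ‖ph χ β - 1‖ * φ (x + β) ≤ 4 * k / p0 := by
      nlinarith [norm_nonneg (ph χ β - 1), phi_pos (x + β), phi_lt_one (x + β)]
    have h5 : k * (1 + 4 / p0) = k + 4 * k / p0 := by ring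
    linarith
  · have e : eta (fun x => ph χ β * χ (x + β)) x = eta χ (x + β) +
        (φ (x + β) - φ x) * (φ (x + β) + φ x) := by
      simp only [eta, norm_mul, hθ β hβ, one_mul]; ring
    rw [e]
    refine (abs_add_le _ _).trans ?_
    have h1 : |(φ (x + β) - φ x) * (φ (x + β) + φ x)| ≤ b * 2 := by
      rw [abs_mul]
      have := phi_pos x; have := phi_lt_one x
      have := phi_pos (x + β); have := phi_lt_one (x + β)
      gcongr
      · exact hlip x
      · rw [abs_of_pos (by positivity)]; linarith
    have h2 : |eta χ (x + β)| ≤ 3 * k := by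
      rcases le_or_gt (x + β) R with h3 | h3
      · have h4 := hw (x + β) (by linarith)
        have e2 : eta χ (x + β) = (‖χ (x + β)‖ - φ (x + β)) *
            ((‖χ (x + β)‖ - φ (x + β)) + 2 * φ (x + β)) := by rw [eta]; ring
        have h5 : |‖χ (x + β)‖ - φ (x + β)| ≤ k := by
          have := abs_norm_sub_norm_le (χ (x + β)) (φ (x + β) : ℂ)
          rw [Complex.norm_real, Real.norm_eq_abs, abs_of_pos (phi_pos _)] at this
          linarith
        rw [e2, abs_mul]
        have p0 := phi_pos (x + β); have p1 := phi_lt_one (x + β)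
        have h6 : |(‖χ (x + β)‖ - φ (x + β)) + 2 * φ (x + β)| ≤ 3 := by
          rw [abs_le] at h5 ⊢
          constructor <;> linarith
        calc _ ≤ k * 3 := by gcongr
          _ = 3 * k := by ring
      · exact (he (x + β) h3).trans (by linarith)
    linarith

end modul
end

open Real MeasureTheory Set ENNReal

lemma adm_of_hyp {R : ℝ} {χ : ℝ → ℂ} (hs : ContDiff ℝ 1 χ)
    (h1 : Integrable (fun x => ‖deriv χ x - ((deriv φ x : ℝ) : ℂ)‖ ^ 2))
    (h2 : Integrable (fun x => W R x * ‖χ x - (φ x : ℂ)‖ ^ 2))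
    (h3 : IntegrableOn (fun x => (‖χ x‖ ^ 2 - (φ x) ^ 2) ^ 2) (Ioi R)) : Adm R χ := by
  have hc := hs.continuous
  refine ⟨hs, ?_, ?_, h3⟩
  · have e : (fun x => ‖deriv χ x - (dphi x : ℂ)‖ ^ 2) =
        fun x => ‖deriv χ x - ((deriv φ x : ℝ) : ℂ)‖ ^ 2 := by
      funext x
      rw [phi_deriv]; rfl
    rw [e]; exact h1
  · refine h2.mono' ?_ (Filter.Eventually.of_forall fun x => ?_)
    · have := om_cont
      have := phi_cont
      exact Continuous.aestronglyMeasurable (by fun_prop)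
    · have := om_pos x
      rw [Real.norm_eq_abs, abs_of_nonneg (by positivity)]
      exact mul_le_mul_of_nonneg_right (om_le_W R x) (by positivity)

lemma exp_I_norm (α : ℝ) : ‖Complex.exp (Complex.I * (α : ℂ))‖ = 1 := by
  rw [mul_comm]; exact Complex.norm_exp_ofReal_mul_I α

lemma exp_of_norm {θ : ℂ} (h : ‖θ‖ = 1) : ∃ α : ℝ, θ = Complex.exp (Complex.I * (α : ℂ)) := by
  refine ⟨θ.arg, ?_⟩
  have := Complex.norm_mul_exp_arg_mul_I θ
  rw [h] at this
  rw [mul_comm]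
  simpa using this.symm

theorem orbital_stability_of_kink (R : ℝ) (hR : 2 / 3 < (φ R) ^ 2)
    (hcoer : ∃ C > (0 : ℝ),
      ∀ u : ℝ → ℝ, Differentiable ℝ u →
        Integrable (fun x => (deriv u x) ^ 2) →
        Integrable (fun x => W R x * (u x) ^ 2) →
        (∫ x : ℝ, u x * deriv φ x) = 0 →
        C * ((∫ x : ℝ, (deriv u x) ^ 2) + ∫ x : ℝ, W R x * (u x) ^ 2) ≤
          (∫ x in Iic R,
            ((deriv u x) ^ 2 + (1 - 12 * (φ x) ^ 2 + 15 * (φ x) ^ 4) * (u x) ^ 2)) +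
          (∫ x in Ioi R,
            ((deriv u x) ^ 2 + (1 - 4 * (φ x) ^ 2 + 3 * (φ x) ^ 4) * (u x) ^ 2))) :
    ∀ ε > (0 : ℝ), ∃ δ > (0 : ℝ), ∀ ψ : ℝ → ℝ → ℂ,
      ContDiff ℝ (⊤ : ℕ∞) (fun p : ℝ × ℝ => ψ p.1 p.2) →
      (∀ t x : ℝ,
        Complex.I * deriv (fun s => ψ s x) t =
          deriv (fun y => deriv (fun y' => ψ t y') y) x - ψ t x +
          4 * ((‖ψ t x‖ ^ 2 : ℝ) : ℂ) * ψ t x - 3 * ((‖ψ t x‖ ^ 4 : ℝ) : ℂ) * ψ t x) →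
      (∀ t : ℝ, Integrable (fun x => ‖deriv (ψ t) x - ((deriv φ x : ℝ) : ℂ)‖ ^ 2)) →
      (∀ t : ℝ, Integrable (fun x => W R x * ‖ψ t x - (φ x : ℂ)‖ ^ 2)) →
      (∀ t : ℝ, IntegrableOn (fun x => (‖ψ t x‖ ^ 2 - (φ x) ^ 2) ^ 2) (Ioi R)) →
      (∀ t : ℝ, energy (ψ t) = energy (ψ 0)) →
      Continuous (fun t : ℝ => ⨅ (α : ℝ) (β : ℝ),
        rho R (fun x => Complex.exp (Complex.I * (α : ℂ)) * ψ t (x + β))) →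
      rho R (ψ 0) ≤ ENNReal.ofReal (δ ^ 2) →
      ∀ t : ℝ,
        (⨅ (α : ℝ) (β : ℝ),
          rho R (fun x => Complex.exp (Complex.I * (α : ℂ)) * ψ t (x + β))) ≤
        ENNReal.ofReal (ε ^ 2) := by
  intro ε hε
  have hR0 : 0 < R := by
    by_contra hn
    have h1 : φ R ≤ φ 0 := phi_mono.monotone (not_lt.1 hn)
    have h2 := phi_pos R
    have h3 := phi_zero_sq
    nlinarith
  obtain ⟨c, hc, κ, hκ, hκ1, hlow⟩ := energy_lower hR hcoer
  obtain ⟨ρ2, hρ2, hmod⟩ := modulation hR0 hκ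
  obtain ⟨ρ3, hρ3, hsup⟩ := sup_left_small R R (zero_lt_one (α := ℝ))
  obtain ⟨ρ4, hρ4, heta⟩ := eta_small R (zero_lt_one (α := ℝ))
  have hom := om_pos R
  obtain ⟨K, hK⟩ : ∃ K, K = 3 + 45 / om R := ⟨_, rfl⟩
  have hK0 : 0 < K := by rw [hK]; positivity
  obtain ⟨A, hA⟩ : ∃ A, A = K / (c * om R) := ⟨_, rfl⟩
  have hA0 : 0 < A := by rw [hA]; positivity
  obtain ⟨d, hd, hd2, hd3, hd4, hd5, hd6⟩ : ∃ d > 0, d < ρ2 ∧ d < ρ3 ∧ d < ρ4 ∧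
      A * d < ρ2 ∧ A * d ≤ ε ^ 2 := by
    obtain ⟨m, hm⟩ : ∃ m, m = min ρ2 (min ρ3 (min ρ4 (min (ρ2 / A) (ε ^ 2 / A)))) := ⟨_, rfl⟩
    have hm0 : 0 < m := by
      rw [hm]
      have : 0 < ρ2 / A := by positivity
      have : 0 < ε ^ 2 / A := by positivity
      simp only [lt_min_iff]; tauto
    have hle : m ≤ ρ2 ∧ m ≤ ρ3 ∧ m ≤ ρ4 ∧ m ≤ ρ2 / A ∧ m ≤ ε ^ 2 / A := by
      have := hm.le
      simpa only [le_min_iff] using this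
    obtain ⟨l1, l2, l3, l4, l5⟩ := hle
    rw [le_div_iff₀ hA0] at l4 l5
    have := mul_pos hm0 hA0
    refine ⟨m / 2, by linarith, by linarith, by linarith, by linarith, by linarith, by linarith⟩
  refine ⟨Real.sqrt d, Real.sqrt_pos.2 hd, ?_⟩
  intro ψ hψ _ hi1 hi2 hi3 hE hcont h0
  rw [Real.sq_sqrt hd.le] at h0
  have hadm : ∀ t, Adm R (ψ t) := fun t => by
    refine adm_of_hyp ?_ (hi1 t) (hi2 t) (hi3 t)
    have h1 : ContDiff ℝ (⊤ : ℕ∞) (fun x : ℝ => ((t, x) : ℝ × ℝ)) :=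
      contDiff_const.prodMk contDiff_id
    have h2 := hψ.comp h1
    exact h2.of_le (by exact_mod_cast le_top)
  have hrr0 : rr R (ψ 0) ≤ d :=
    (ENNReal.ofReal_le_ofReal_iff hd.le).1 ((hadm 0).rr_le.trans h0)
  have hw1 := hsup (ψ 0) (hadm 0) (by linarith)
  have he1 := heta (ψ 0) (hadm 0) (by linarith)
  have hup := (hadm 0).DD_upper hw1 he1
  rw [← hK] at hup
  have hup2 : ∫ x, DD (ψ 0) x ≤ K * d :=
    hup.trans (mul_le_mul_of_nonneg_left hrr0 hK0.le)
  obtain ⟨hen0, hnn0⟩ := (hadm 0).energy_eq ((hadm 0).DD_int hw1 he1)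
  have step : ∀ t, (⨅ (α : ℝ) (β : ℝ),
        rho R (fun x => Complex.exp (Complex.I * (α : ℂ)) * ψ t (x + β))) < ENNReal.ofReal ρ2 →
      (⨅ (α : ℝ) (β : ℝ),
        rho R (fun x => Complex.exp (Complex.I * (α : ℂ)) * ψ t (x + β))) ≤
        ENNReal.ofReal (A * d) := by
    intro t ht
    obtain ⟨α, ht⟩ := iInf_lt_iff.1 ht
    obtain ⟨β, ht⟩ := iInf_lt_iff.1 ht
    have hχ := (hadm t).shift (exp_I_norm α) β
    have hr : rr R (fun x => Complex.exp (Complex.I * (α : ℂ)) * ψ t (x + β)) < ρ2 :=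
      (ENNReal.ofReal_lt_ofReal_iff hρ2).1 (hχ.rr_le.trans_lt ht)
    obtain ⟨θ, b, hθ, him, horth, hl, hr2⟩ := hmod _ hχ hr
    have hχ2 := hχ.shift hθ b
    have hen : energy (fun x => θ * (Complex.exp (Complex.I * (α : ℂ)) * ψ t (x + b + β))) = energy (ψ 0) := by
      exact (energy_shift (fun x => Complex.exp (Complex.I * (α : ℂ)) * ψ t (x + β)) hθ b).trans
        ((energy_shift (ψ t) (exp_I_norm α) β).trans (hE t))
    have hlo := hlow _ hχ2 him horth hl hr2
    obtain ⟨hen2, hnn2⟩ := hχ2.energy_eq (hχ2.DD_int (fun x hx => (hl x hx).trans hκ1)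
      (fun x hx => (hr2 x hx).trans hκ1))
    rw [hen, hen0] at hen2
    have heq := (ENNReal.ofReal_eq_ofReal_iff hnn0 hnn2).1 hen2
    have hrr : rr R (fun x => θ * (Complex.exp (Complex.I * (α : ℂ)) * ψ t (x + b + β))) / om R ≤ A * d := by
      have e : A * d = (K * d / c) / om R := by rw [hA]; field_simp
      rw [e]
      refine div_le_div_of_nonneg_right ?_ hom.le
      rw [le_div_iff₀ hc]
      linarith
    have hfin := hχ2.le_rr.trans (ENNReal.ofReal_le_ofReal hrr)
    obtain ⟨α1, rfl⟩ := exp_of_norm hθ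
    refine (iInf_le_of_le (α1 + α) (iInf_le_of_le (b + β) (le_of_eq ?_))).trans hfin
    congr 1
    funext x
    rw [← mul_assoc, ← Complex.exp_add, add_assoc]
    push_cast
    ring_nf
  have h00 : (⨅ (α : ℝ) (β : ℝ),
        rho R (fun x => Complex.exp (Complex.I * (α : ℂ)) * ψ 0 (x + β))) < ENNReal.ofReal ρ2 := by
    refine lt_of_le_of_lt ?_ ((ENNReal.ofReal_lt_ofReal_iff hρ2).2 hd2)
    refine le_trans ?_ h0
    refine iInf_le_of_le 0 (iInf_le_of_le 0 (le_of_eq ?_))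
    simp
  have hAlt : ENNReal.ofReal (A * d) < ENNReal.ofReal ρ2 :=
    (ENNReal.ofReal_lt_ofReal_iff hρ2).2 hd5
  obtain ⟨m, hm⟩ : ∃ m : ℝ → ℝ≥0∞, m = fun t => (⨅ (α : ℝ) (β : ℝ),
        rho R (fun x => Complex.exp (Complex.I * (α : ℂ)) * ψ t (x + β))) := ⟨_, rfl⟩
  rw [← hm] at hcont
  have hstep : ∀ t, m t < ENNReal.ofReal ρ2 → m t ≤ ENNReal.ofReal (A * d) := by
    rw [hm]; exact step
  have hclopen : IsClopen {t | m t ≤ ENNReal.ofReal (A * d)} := by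
    refine ⟨isClosed_le hcont continuous_const, ?_⟩
    have e : {t | m t ≤ ENNReal.ofReal (A * d)} = {t | m t < ENNReal.ofReal ρ2} := by
      ext t
      exact ⟨fun h => lt_of_le_of_lt h hAlt, fun h => hstep t h⟩
    rw [e]
    exact isOpen_lt hcont continuous_const
  have huniv := hclopen.eq_univ ⟨0, hstep 0 (by rw [hm]; exact h00)⟩
  intro t
  have ht : t ∈ {t | m t ≤ ENNReal.ofReal (A * d)} := by rw [huniv]; trivial
  have ht2 : m t ≤ ENNReal.ofReal (ε ^ 2) := le_trans ht (ENNReal.ofReal_le_ofReal hd6)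
  rw [hm] at ht2
  exact ht2
end

section
/- If ψ : ℝ → ℂ is locally absolutely continuous with ψ' ∈ L²(ℝ) and x ↦ ψ(x)(1 - |ψ(x)|²) ∈ L²(ℝ), then either ψ(x) → 0 as x → +∞ or |ψ(x)| → 1 as x → +∞; and likewise either ψ(x) → 0 as x → -∞ or |ψ(x)| → 1 as x → -∞. -/
open Real MeasureTheory Filter Topology

theorem energy_limit_zero_of_integrable {f : ℝ → ℝ} {c : ℝ} (hf : Integrable f)
    (h : Tendsto f atTop (𝓝 c)) : c ≤ 0 := by
  by_contra! hc
  obtain ⟨A, hA⟩ := eventually_atTop.1 (h.eventually (lt_mem_nhds (half_lt_self hc)))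
  have h1 : IntegrableOn (fun _ : ℝ => c / 2) (Set.Ioi A) := by
    refine Integrable.mono' (hf.integrableOn (s := Set.Ioi A)) aestronglyMeasurable_const ?_
    refine (ae_restrict_iff' measurableSet_Ioi).2 (Eventually.of_forall fun x hx => ?_)
    rw [Real.norm_of_nonneg (by positivity)]
    exact (hA x (le_of_lt hx)).le
  rw [integrableOn_const_iff] at h1
  simp [hc.ne'] at h1

theorem energy_space_limit_top (ψ : ℝ → ℂ)
    (hdiff : Differentiable ℝ ψ)
    (hderiv : Integrable (fun x => ‖deriv ψ x‖ ^ 2))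
    (hpot : Integrable (fun x => ‖ψ x * (1 - (‖ψ x‖ ^ 2 : ℝ))‖ ^ 2)) :
    Tendsto ψ atTop (𝓝 0) ∨ Tendsto (fun x => ‖ψ x‖) atTop (𝓝 1) := by
  have hW : ∀ x, ‖ψ x * (1 - (‖ψ x‖ ^ 2 : ℝ))‖ ^ 2 = ‖ψ x‖ ^ 2 * (1 - ‖ψ x‖ ^ 2) ^ 2 := by
    intro x
    have : (1 - ((‖ψ x‖ ^ 2 : ℝ) : ℂ)) = ((1 - ‖ψ x‖ ^ 2 : ℝ) : ℂ) := by push_cast; rfl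
    rw [this, norm_mul, mul_pow, Complex.norm_real, Real.norm_eq_abs, sq_abs]
  simp_rw [hW] at hpot
  have hs : ∀ x, HasDerivAt (fun y => ‖ψ y‖ ^ 2) (2 * inner ℝ (ψ x) (deriv ψ x)) x := fun x =>
    (hdiff x).hasDerivAt.norm_sq
  have hF : ∀ x, HasDerivAt (fun y => (1 - ‖ψ y‖ ^ 2) ^ 2)
      (-4 * (1 - ‖ψ x‖ ^ 2) * inner ℝ (ψ x) (deriv ψ x)) x := by
    intro x
    refine (((hs x).const_sub 1).pow 2).congr_deriv ?_
    simp; ring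
  have hFi : Integrable (deriv (fun y => (1 - ‖ψ y‖ ^ 2) ^ 2)) := by
    refine Integrable.mono' ((hpot.add hderiv).const_mul 2)
      (measurable_deriv _).aestronglyMeasurable (Eventually.of_forall fun x => ?_)
    rw [(hF x).deriv]
    have h1 := abs_real_inner_le_norm (ψ x) (deriv ψ x)
    simp only [Pi.add_apply, Real.norm_eq_abs, abs_mul, abs_neg]
    have h2 : |(4:ℝ)| = 4 := by norm_num
    rw [h2]
    have h3 : 4 * |1 - ‖ψ x‖ ^ 2| * |inner ℝ (ψ x) (deriv ψ x)|
        ≤ 4 * |1 - ‖ψ x‖ ^ 2| * (‖ψ x‖ * ‖deriv ψ x‖) := by gcongr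
    have h4 := sq_nonneg (‖ψ x‖ * |1 - ‖ψ x‖ ^ 2| - ‖deriv ψ x‖)
    have h5 := sq_abs (1 - ‖ψ x‖ ^ 2)
    rw [← h5]
    nlinarith
  have hlim := tendsto_limUnder_of_hasDerivAt_of_integrableOn_Ioi (a := 0)
    (f := fun y => (1 - ‖ψ y‖ ^ 2) ^ 2) (f' := deriv (fun y => (1 - ‖ψ y‖ ^ 2) ^ 2))
    (fun x _ => (hF x).differentiableAt.hasDerivAt) hFi.integrableOn
  generalize limUnder atTop (fun y => (1 - ‖ψ y‖ ^ 2) ^ 2) = M at hlim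
  have hM : 0 ≤ M := ge_of_tendsto' hlim fun x => sq_nonneg _
  have habs : Tendsto (fun y => |1 - ‖ψ y‖ ^ 2|) atTop (𝓝 (√M)) := by
    simpa [Real.sqrt_sq_eq_abs] using hlim.sqrt
  have hnorm : ∀ c, Tendsto (fun y => ‖ψ y‖ ^ 2) atTop (𝓝 c) →
      Tendsto (fun y => ‖ψ y‖) atTop (𝓝 (√c)) := by
    intro c h
    simpa [Real.sqrt_sq] using h.sqrt
  rcases hM.eq_or_lt with rfl | hM
  · right
    rw [Real.sqrt_zero] at habs
    have h1 := (tendsto_zero_iff_abs_tendsto_zero _).2 habs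
    have h2 := hnorm 1 (by simpa using h1.const_sub 1)
    simpa using h2
  · left
    have hconv : ∃ c, Tendsto (fun y => ‖ψ y‖ ^ 2) atTop (𝓝 c) := by
      obtain ⟨A, hA⟩ := eventually_atTop.1 (hlim.eventually (lt_mem_nhds hM))
      have hc : Continuous fun y => ‖ψ y‖ ^ 2 := hdiff.continuous.norm.pow 2
      have hne : ∀ x ≥ A, ‖ψ x‖ ^ 2 ≠ 1 := by
        intro x hx h
        have := hA x hx
        simp [h] at this
      have hoc := (isPreconnected_Ici (a := A)).image _ hc.continuousOn |>.ordConnected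
      rcases lt_or_gt_of_ne (hne A le_rfl) with h0 | h0
      · refine ⟨1 - √M, ?_⟩
        have : ∀ x ≥ A, ‖ψ x‖ ^ 2 < 1 := by
          intro x hx
          by_contra! h
          obtain ⟨z, hz, hz'⟩ := hoc.out ⟨A, le_refl A, rfl⟩ ⟨x, hx, rfl⟩ ⟨h0.le, h⟩
          exact hne z hz hz'
        refine (habs.const_sub 1).congr' ?_
        filter_upwards [eventually_ge_atTop A] with x hx
        rw [abs_of_pos (by linarith [this x hx])]; ring
      · refine ⟨1 + √M, ?_⟩
        have : ∀ x ≥ A, 1 < ‖ψ x‖ ^ 2 := by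
          intro x hx
          by_contra! h
          obtain ⟨z, hz, hz'⟩ := hoc.out ⟨x, hx, rfl⟩ ⟨A, le_refl A, rfl⟩ ⟨h, h0.le⟩
          exact hne z hz hz'
        refine (habs.const_add 1).congr' ?_
        filter_upwards [eventually_ge_atTop A] with x hx
        rw [abs_of_neg (by linarith [this x hx])]; ring
    obtain ⟨c, hc⟩ := hconv
    have h1 := energy_limit_zero_of_integrable hpot (hc.mul hlim)
    have h2 : c ≤ 0 := by
      by_contra! h
      have := mul_pos h hM
      linarith
    have h3 := hnorm c hc
    rw [Real.sqrt_eq_zero_of_nonpos h2] at h3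
    exact tendsto_zero_iff_norm_tendsto_zero.2 h3

theorem energy_space_limits (ψ : ℝ → ℂ)
    (hdiff : Differentiable ℝ ψ)
    (hderiv : Integrable (fun x => ‖deriv ψ x‖ ^ 2))
    (hpot : Integrable (fun x => ‖ψ x * (1 - (‖ψ x‖ ^ 2 : ℝ))‖ ^ 2)) :
    (Tendsto ψ atTop (𝓝 0) ∨ Tendsto (fun x => ‖ψ x‖) atTop (𝓝 1)) ∧
    (Tendsto ψ atBot (𝓝 0) ∨ Tendsto (fun x => ‖ψ x‖) atBot (𝓝 1)) := by
  refine ⟨energy_space_limit_top ψ hdiff hderiv hpot, ?_⟩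
  have h := energy_space_limit_top (fun x => ψ (-x)) (hdiff.comp differentiable_neg)
    (by simpa [deriv_comp_neg] using hderiv.comp_neg) hpot.comp_neg
  rcases h with h | h
  · left
    simpa [Function.comp_def] using h.comp tendsto_neg_atBot_atTop
  · right
    simpa [Function.comp_def] using h.comp tendsto_neg_atBot_atTop
end
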